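/- arXiv:0911.4196 — 2 statements merged into one kernel-verified Lean document; each statement's English description precedes it below -/
import Mathlib

section
/- Suppose dim T ≥ 1 and every associated prime P of the T-module T/pT satisfies P ⊆ ⋃_{i=1}^k Qᵢ. Let (R, R ∩ 𝔪) be a pca subring of T such that pT ∩ R = pR, let I be a finitely generated ideal of R, and let c ∈ IT ∩ R. Then there exists a pca subring S of T such that: (1) R ⊆ S ⊆ T; (2) Γ(S) = Γ(R); (3) c ∈ IS; and (4) pT ∩ S = pS. -/
universe u

/-- `Γ(X) = max(|X|, ℵ₀)`. -/
noncomputable def Gamma (X : Type u) : Cardinal.{u} :=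
  max (Cardinal.mk X) Cardinal.aleph0

/-- The set `(Q \ pT)R = {t ∈ T | t = qr for some q ∈ Q \ pT, r ∈ R}`. -/
def CompAvoid {T : Type u} [CommRing T] (Q : Ideal T) (p : T) (R : Set T) : Set T :=
  {t : T | ∃ q ∈ Q, q ∉ Ideal.span {p} ∧ ∃ r ∈ R, t = q * r}

/-- `R` is quasilocal with maximal ideal `R ∩ 𝔪`: every element of `R` outside the
maximal ideal of `T` is a unit of `R`. -/
def QuasilocalWithMaxIdeal {T : Type u} [CommRing T] [IsLocalRing T] (R : Subring T) : Prop :=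
  ∀ x : R, (x : T) ∉ IsLocalRing.maximalIdeal T → IsUnit x

/-- `R` is a `p`ca (`pT`-complement avoiding) subring of `T`:
`(R, R ∩ 𝔪)` is quasilocal, `p ∈ R`, `Γ(R) < |T|`, `R ∩ P = (0)` for every associated
prime `P` of `T`, and `((Qᵢ \ pT)R) ∩ R = {0}` for all `i`. -/
def IsPcaSubring {T : Type u} [CommRing T] [IsLocalRing T] {k : ℕ}
    (Q : Fin k → Ideal T) (p : T) (R : Subring T) : Prop :=
  p ∈ R ∧ QuasilocalWithMaxIdeal R ∧
  Gamma ↥R < Cardinal.mk T ∧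
  (∀ P ∈ associatedPrimes T T, ∀ x ∈ R, x ∈ P → x = 0) ∧
  (∀ i : Fin k, ∀ t ∈ CompAvoid (Q i) p (R : Set T), t ∈ R → t = 0)


open Cardinal IsLocalRing in
theorem mk_quotient_maximalIdeal_pow_le {T : Type u} [CommRing T] [IsLocalRing T]
    [IsNoetherianRing T] (n : ℕ) :
    #(T ⧸ maximalIdeal T ^ n) ≤ max #(T ⧸ maximalIdeal T) ℵ₀ := by
  induction n with
  | zero =>
    have : Subsingleton (T ⧸ maximalIdeal T ^ 0) := by
      rw [Ideal.Quotient.subsingleton_iff]; simp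
    exact (Cardinal.le_one_iff_subsingleton.mpr this).trans (Cardinal.one_le_aleph0.trans (le_max_right _ _))
  | succ n ih =>
    obtain ⟨d, x, hx⟩ := Submodule.fg_iff_exists_fin_generating_family.mp
      (IsNoetherian.noetherian (maximalIdeal T))
    let F : (T ⧸ maximalIdeal T) × (Fin d → T ⧸ maximalIdeal T ^ n) →
        T ⧸ maximalIdeal T ^ (n + 1) := fun ab =>
      Ideal.Quotient.mk _ (ab.1.out + ∑ i, (ab.2 i).out * x i)
    have hF : Function.Surjective F := by
      intro y
      obtain ⟨t, rfl⟩ := Ideal.Quotient.mk_surjective y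
      have h1 : t - (Ideal.Quotient.mk (maximalIdeal T) t).out ∈ maximalIdeal T := by
        rw [← Ideal.Quotient.eq]
        exact (Quotient.out_eq' (Ideal.Quotient.mk (maximalIdeal T) t)).symm
      obtain ⟨c, hc⟩ := (Submodule.mem_span_range_iff_exists_fun T).mp (hx.ge h1)
      refine ⟨(Ideal.Quotient.mk _ t, fun i => Ideal.Quotient.mk _ (c i)), ?_⟩
      refine Ideal.Quotient.eq.mpr ?_
      have h2 : (Ideal.Quotient.mk (maximalIdeal T) t).out +
          ∑ i, (Ideal.Quotient.mk (maximalIdeal T ^ n) (c i)).out * x i - t =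
          ∑ i, ((Ideal.Quotient.mk (maximalIdeal T ^ n) (c i)).out - c i) * x i := by
        simp only [sub_mul, Finset.sum_sub_distrib]
        simp only [smul_eq_mul] at hc
        rw [hc]; ring
      rw [h2]
      refine Ideal.sum_mem _ fun i _ => ?_
      rw [pow_succ]
      refine Ideal.mul_mem_mul ?_ ?_
      · rw [← Ideal.Quotient.eq]
        exact Quotient.out_eq' (Ideal.Quotient.mk (maximalIdeal T ^ n) (c i))
      · rw [← hx]; exact Submodule.subset_span ⟨i, rfl⟩
    refine (Cardinal.mk_le_of_surjective hF).trans ?_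
    rw [Cardinal.mk_prod, Cardinal.lift_id, Cardinal.lift_id]
    have h3 : #(Fin d → T ⧸ maximalIdeal T ^ n) ≤ max #(T ⧸ maximalIdeal T) ℵ₀ := by
      have : #(Fin d → T ⧸ maximalIdeal T ^ n) = #(T ⧸ maximalIdeal T ^ n) ^ d := by
        simp
      rw [this]
      calc #(T ⧸ maximalIdeal T ^ n) ^ d ≤ max #(T ⧸ maximalIdeal T ^ n) ℵ₀ := by
            rw [← Cardinal.power_natCast]; exact Cardinal.power_nat_le_max
        _ ≤ _ := max_le ih (le_max_right _ _)
    calc _ ≤ max #(T ⧸ maximalIdeal T) ℵ₀ * max #(T ⧸ maximalIdeal T) ℵ₀ :=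
          mul_le_mul' (le_max_left _ _) h3
      _ = _ := Cardinal.mul_eq_self (le_max_right _ _)

open Cardinal IsLocalRing in
theorem mk_le_mk_residue_pow_aleph0 {T : Type u} [CommRing T] [IsLocalRing T]
    [IsNoetherianRing T] : #T ≤ #(T ⧸ maximalIdeal T) ^ ℵ₀ := by
  have hne : Nontrivial (T ⧸ maximalIdeal T) := Ideal.Quotient.nontrivial_iff.mpr
    (maximalIdeal.isMaximal T).ne_top
  have h2 : (2 : Cardinal) ≤ #(T ⧸ maximalIdeal T) :=
    Cardinal.two_le_iff_one_lt.mpr (Cardinal.one_lt_iff_nontrivial.mpr hne)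
  let F : T → ∀ n : ℕ, T ⧸ maximalIdeal T ^ n := fun t n => Ideal.Quotient.mk _ t
  have hF : Function.Injective F := by
    intro a b hab
    have h : a - b ∈ ⨅ n, maximalIdeal T ^ n := by
      rw [Ideal.mem_iInf]
      intro n
      exact Ideal.Quotient.eq.mp (congrFun hab n)
    rw [Ideal.iInf_pow_eq_bot_of_isLocalRing _ (maximalIdeal.isMaximal T).ne_top] at h
    exact sub_eq_zero.mp h
  have h0 : (0 : Cardinal) < #(T ⧸ maximalIdeal T) := lt_of_lt_of_le (by norm_num) h2
  calc #T ≤ #(∀ n : ℕ, T ⧸ maximalIdeal T ^ n) := Cardinal.mk_le_of_injective hF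
    _ = Cardinal.prod fun n : ℕ => #(T ⧸ maximalIdeal T ^ n) := Cardinal.mk_pi _
    _ ≤ Cardinal.prod fun _ : ℕ => #(T ⧸ maximalIdeal T) * ℵ₀ :=
        Cardinal.prod_le_prod _ _ fun n => (mk_quotient_maximalIdeal_pow_le n).trans
          (max_le (Cardinal.le_mul_right Cardinal.aleph0_ne_zero)
            (Cardinal.le_mul_left h0.ne'))
    _ = (#(T ⧸ maximalIdeal T) * ℵ₀) ^ ℵ₀ := by simp
    _ = #(T ⧸ maximalIdeal T) ^ ℵ₀ * 2 ^ ℵ₀ := by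
        rw [Cardinal.mul_power, Cardinal.power_self_eq le_rfl]
    _ ≤ #(T ⧸ maximalIdeal T) ^ ℵ₀ * #(T ⧸ maximalIdeal T) ^ ℵ₀ :=
        mul_le_mul' le_rfl (Cardinal.power_le_power_right h2)
    _ = #(T ⧸ maximalIdeal T) ^ ℵ₀ := by
        rw [← Cardinal.power_add, Cardinal.aleph0_add_aleph0]

open Cardinal IsLocalRing in
theorem mk_residue_pow_aleph0_le_mk_quotient {T : Type u} [CommRing T] [IsLocalRing T]
    [IsNoetherianRing T] [IsAdicComplete (maximalIdeal T) T] (P : Ideal T) (hP : P.IsPrime)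
    (hPm : P ≠ maximalIdeal T) : #(T ⧸ maximalIdeal T) ^ ℵ₀ ≤ #(T ⧸ P) := by
  obtain ⟨x, hxm, hxP⟩ : ∃ x ∈ maximalIdeal T, x ∉ P := by
    by_contra! h
    exact hPm (le_antisymm (le_maximalIdeal hP.ne_top) h)
  let S : (ℕ → T ⧸ maximalIdeal T) → ℕ → T := fun a n =>
    ∑ i ∈ Finset.range n, (a i).out * x ^ i
  have hS : ∀ a, ∃ L, ∀ n, S a n ≡ L [SMOD (maximalIdeal T ^ n • ⊤ : Submodule T T)] := by
    intro a
    refine IsPrecomplete.prec (IsAdicComplete.toIsPrecomplete) ?_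
    intro m n hmn
    rw [SModEq.sub_mem, ← neg_mem_iff, neg_sub]
    simp only [S]
    rw [← Finset.sum_Ico_eq_sub _ hmn]
    refine Submodule.sum_mem _ fun i hi => ?_
    rw [smul_eq_mul, Ideal.mul_top]
    exact Ideal.mul_mem_left _ _
      (Ideal.pow_le_pow_right (Finset.mem_Ico.mp hi).1 (Ideal.pow_mem_pow hxm i))
  choose L hL using hS
  have hinj : Function.Injective fun a => Ideal.Quotient.mk P (L a) := by
    intro a b hab
    by_contra hne
    have hex : ∃ n, a n ≠ b n := by
      by_contra! h
      exact hne (funext h)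
    classical
    let n := Nat.find hex
    have hn : a n ≠ b n := Nat.find_spec hex
    have hlt : ∀ i < n, a i = b i := fun i hi => by
      by_contra h
      exact Nat.find_min hex hi h
    have hu : ∀ N, ∃ u, IsUnit u ∧ S a (n + 1 + N) - S b (n + 1 + N) = x ^ n * u := by
      intro N
      induction N with
      | zero =>
        refine ⟨(a n).out - (b n).out, ?_, ?_⟩
        · by_contra h
          apply hn
          have h' : (a n).out - (b n).out ∈ maximalIdeal T := h
          rw [← Ideal.Quotient.eq] at h'
          calc a n = Ideal.Quotient.mk _ (a n).out := (Quotient.out_eq' _).symm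
            _ = _ := h'
            _ = b n := Quotient.out_eq' _
        · simp only [S, add_zero, Finset.sum_range_succ]
          rw [Finset.sum_congr rfl fun i hi => by rw [hlt i (Finset.mem_range.mp hi)]]
          ring
      | succ N ih =>
        obtain ⟨u, hu, he⟩ := ih
        refine ⟨u + x ^ (N + 1) * ((a (n + 1 + N)).out - (b (n + 1 + N)).out), ?_, ?_⟩
        · by_contra h
          have h' := (maximalIdeal T).sub_mem h (Ideal.mul_mem_right
            ((a (n + 1 + N)).out - (b (n + 1 + N)).out) _
              (Ideal.pow_mem_of_mem _ hxm (N + 1) N.succ_pos))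
          rw [add_sub_cancel_right] at h'
          exact h' hu
        · have e1 : ∀ c, S c (n + 1 + (N + 1)) =
              S c (n + 1 + N) + (c (n + 1 + N)).out * x ^ (n + 1 + N) :=
            fun c => Finset.sum_range_succ _ _
          rw [e1, e1, mul_add, ← he]
          ring
    have hmem : Ideal.Quotient.mk P (x ^ n) ∈
        ⨅ i, maximalIdeal T ^ i • (⊤ : Submodule T (T ⧸ P)) := by
      rw [Submodule.mem_iInf]
      intro N
      obtain ⟨u, hu, he⟩ := hu N
      have ha := hL a (n + 1 + N)
      have hb := hL b (n + 1 + N)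
      rw [SModEq.sub_mem, smul_eq_mul, Ideal.mul_top] at ha hb
      have hy : x ^ n * u - (L a - L b) ∈ maximalIdeal T ^ N := by
        have : x ^ n * u - (L a - L b) =
          (S a (n + 1 + N) - L a) - (S b (n + 1 + N) - L b) := by rw [← he]; ring
        rw [this]
        exact Ideal.pow_le_pow_right (by omega) (Ideal.sub_mem _ ha hb)
      obtain ⟨v, rfl⟩ := hu
      have h4 : Ideal.Quotient.mk P (x ^ n) =
          (↑v⁻¹ * (x ^ n * ↑v - (L a - L b))) • (1 : T ⧸ P) := by
        have h5 : Ideal.Quotient.mk P (L a - L b) = 0 := by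
          rw [map_sub]; exact sub_eq_zero.mpr hab
        rw [Algebra.smul_def, mul_one, Ideal.Quotient.algebraMap_eq, map_mul, map_sub, h5,
          sub_zero, ← map_mul]
        congr 1
        rw [mul_comm, mul_assoc, Units.mul_inv, mul_one]
      rw [h4]
      exact Submodule.smul_mem_smul (Ideal.mul_mem_left _ _ hy) trivial
    rw [Ideal.iInf_pow_smul_eq_bot_of_isLocalRing _ (maximalIdeal.isMaximal T).ne_top,
      Submodule.mem_bot, Ideal.Quotient.eq_zero_iff_mem] at hmem
    exact hxP (hP.mem_of_pow_mem _ hmem)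
  have := Cardinal.mk_le_of_injective hinj
  simpa using this

/-- A subring of `T` that contains `p`, whose nonzero elements are regular in `T`, which is
closed under division in `T`, and which meets each `Q i` inside `pT`. -/
structure IsDivClosedAvoiding {T : Type u} [CommRing T] {k : ℕ} (Q : Fin k → Ideal T) (p : T)
    (R : Subring T) : Prop where
  p_mem : p ∈ R
  regular : ∀ r ∈ R, r ≠ 0 → r ∈ nonZeroDivisors T
  div_mem : ∀ t, ∀ r ∈ R, r ≠ 0 → t * r ∈ R → t ∈ R
  avoid : ∀ i, ∀ x ∈ R, x ∈ Q i → p ∣ x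

/-- The elements of `T` that are quotients of an element of `R` by an element of `R` regular
in `T`. -/
def divClosure {T : Type u} [CommRing T] (R : Subring T) : Subring T where
  carrier := {t | ∃ r ∈ R, r ∈ nonZeroDivisors T ∧ t * r ∈ R}
  mul_mem' := by
    rintro a b ⟨r, hr, hr', har⟩ ⟨s, hs, hs', hbs⟩
    refine ⟨r * s, R.mul_mem hr hs, mul_mem hr' hs', ?_⟩
    rw [mul_mul_mul_comm]
    exact R.mul_mem har hbs
  one_mem' := ⟨1, R.one_mem, one_mem _, by simp⟩
  add_mem' := by
    rintro a b ⟨r, hr, hr', har⟩ ⟨s, hs, hs', hbs⟩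
    refine ⟨r * s, R.mul_mem hr hs, mul_mem hr' hs', ?_⟩
    have : (a + b) * (r * s) = (a * r) * s + (b * s) * r := by ring
    rw [this]
    exact R.add_mem (R.mul_mem har hs) (R.mul_mem hbs hr)
  zero_mem' := ⟨1, R.one_mem, one_mem _, by simp⟩
  neg_mem' := by
    rintro a ⟨r, hr, hr', har⟩
    exact ⟨r, hr, hr', by simpa using R.neg_mem har⟩

theorem le_divClosure {T : Type u} [CommRing T] (R : Subring T) : R ≤ divClosure R :=
  fun x hx => ⟨1, R.one_mem, one_mem _, by simpa using hx⟩

theorem Gamma_divClosure_le {T : Type u} [CommRing T] (R : Subring T) :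
    Gamma (divClosure R) ≤ Gamma R := by
  choose r hr hr' hm using fun t : divClosure R => t.2
  have hinj : Function.Injective fun t : divClosure R =>
      ((⟨r t, hr t⟩, ⟨t * r t, hm t⟩) : R × R) := by
    intro a b hab
    simp only [Prod.mk.injEq, Subtype.mk.injEq] at hab
    obtain ⟨h1, h2⟩ := hab
    rw [h1] at h2
    exact Subtype.ext ((mul_cancel_right_mem_nonZeroDivisors (hr' b)).mp h2)
  refine max_le ((Cardinal.mk_le_of_injective hinj).trans ?_) (le_max_right _ _)
  rw [Cardinal.mk_prod, Cardinal.lift_id]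
  exact (mul_le_mul' (le_max_left _ _) (le_max_left _ _)).trans
    (Cardinal.mul_eq_self (le_max_right _ _)).le

theorem isDivClosedAvoiding_divClosure {T : Type u} [CommRing T] [Nontrivial T] {k : ℕ}
    {Q : Fin k → Ideal T} {p : T} {R : Subring T} (hp : p ∈ R)
    (hreg : ∀ r ∈ R, r ≠ 0 → r ∈ nonZeroDivisors T)
    (havoid : ∀ i, ∀ q ∈ Q i, ∀ r ∈ R, r ≠ 0 → q * r ∈ R → p ∣ q) :
    IsDivClosedAvoiding Q p (divClosure R) := by
  have hreg' : ∀ r ∈ divClosure R, r ≠ 0 → r ∈ nonZeroDivisors T := by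
    rintro t ⟨r, hr, hr', htr⟩ ht
    have h0 : t * r ≠ 0 := fun h => ht ((mul_right_mem_nonZeroDivisors_eq_zero_iff hr').mp h)
    exact (mul_mem_nonZeroDivisors.mp (hreg _ htr h0)).1
  refine ⟨le_divClosure R hp, hreg', ?_, ?_⟩
  · rintro t s hs hs0 ⟨r', hr', hr'', h1⟩
    have hsreg := hreg' s hs hs0
    obtain ⟨r, hr, hr2, h2⟩ := hs
    refine ⟨s * r * r', R.mul_mem h2 hr', mul_mem (mul_mem hsreg hr2) hr'', ?_⟩
    have : t * (s * r * r') = (t * s * r') * r := by ring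
    rw [this]
    exact R.mul_mem h1 hr
  · rintro i x ⟨r, hr, hr', h⟩ hx
    exact havoid i x hx r hr (nonZeroDivisors.ne_zero hr') h

theorem mem_nonZeroDivisors_iff_forall_associatedPrimes {T : Type u} [CommRing T]
    [IsNoetherianRing T] (x : T) :
    x ∈ nonZeroDivisors T ↔ ∀ P ∈ associatedPrimes T T, x ∉ P := by
  have h := Set.ext_iff.mp (biUnion_associatedPrimes_eq_compl_nonZeroDivisors T) x
  simp only [Set.mem_iUnion, SetLike.mem_coe, Set.mem_compl_iff, exists_prop] at h
  rw [← not_iff_not, ← h]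
  push Not
  rfl

theorem IsDivClosedAvoiding.isPcaSubring {T : Type u} [CommRing T] [IsLocalRing T]
    [IsNoetherianRing T] {k : ℕ} {Q : Fin k → Ideal T} {p : T} {R : Subring T}
    (h : IsDivClosedAvoiding Q p R) (hcard : Gamma R < Cardinal.mk T) : IsPcaSubring Q p R := by
  refine ⟨h.p_mem, ?_, hcard, ?_, ?_⟩
  · intro x hx
    have hu : IsUnit (x : T) := by
      by_contra hn
      exact hx hn
    obtain ⟨v, hv⟩ := hu
    have hx0 : (x : T) ≠ 0 := by rw [← hv]; exact v.ne_zero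
    have h1 : (↑v⁻¹ : T) * x = 1 := by rw [← hv, Units.inv_mul]
    have hm : (↑v⁻¹ : T) ∈ R := h.div_mem _ x x.2 hx0 (by rw [h1]; exact R.one_mem)
    refine IsUnit.of_mul_eq_one ⟨_, hm⟩ (Subtype.ext ?_)
    simpa [mul_comm] using h1
  · intro P hP x hx hxP
    by_contra h0
    exact (mem_nonZeroDivisors_iff_forall_associatedPrimes x).mp (h.regular x hx h0) P hP hxP
  · rintro i t ⟨q, hq, hqp, r, hr, rfl⟩ ht
    by_cases h0 : r = 0
    · rw [h0, mul_zero]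
    · exact absurd (Ideal.mem_span_singleton.mpr (h.avoid i q (h.div_mem q r hr h0 ht) hq)) hqp

theorem IsPcaSubring.isDivClosedAvoiding_divClosure {T : Type u} [CommRing T] [IsLocalRing T]
    [IsNoetherianRing T] {k : ℕ} {Q : Fin k → Ideal T} {p : T} {R : Subring T}
    (h : IsPcaSubring Q p R) : IsDivClosedAvoiding Q p (divClosure R) := by
  obtain ⟨hp, -, -, hass, hQ⟩ := h
  have hreg : ∀ r ∈ R, r ≠ 0 → r ∈ nonZeroDivisors T := fun r hr h0 =>
    (mem_nonZeroDivisors_iff_forall_associatedPrimes r).mpr fun P hP hrP => h0 (hass P hP r hr hrP)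
  refine _root_.isDivClosedAvoiding_divClosure hp hreg ?_
  intro i q hq r hr h0 hqr
  by_contra hn
  have h1 := hQ i _ ⟨q, hq, fun hh => hn (Ideal.mem_span_singleton.mp hh), r, hr, rfl⟩ hqr
  rw [mul_right_mem_nonZeroDivisors_eq_zero_iff (hreg r hr h0)] at h1
  exact hn (h1 ▸ dvd_zero p)

theorem finiteMultiplicity_of_mem_maximalIdeal {T : Type u} [CommRing T] [IsLocalRing T]
    [IsNoetherianRing T] {p x : T} (hp : p ∈ IsLocalRing.maximalIdeal T) (hx : x ≠ 0) :
    FiniteMultiplicity p x := by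
  by_contra h
  rw [FiniteMultiplicity.not_iff_forall] at h
  have hmem : x ∈ ⨅ n, IsLocalRing.maximalIdeal T ^ n := by
    rw [Ideal.mem_iInf]
    exact fun n => Ideal.mem_of_dvd _ (h n) (Ideal.pow_mem_pow hp n)
  rw [Ideal.iInf_pow_eq_bot_of_isLocalRing _
    (IsLocalRing.maximalIdeal.isMaximal T).ne_top] at hmem
  exact hx hmem

theorem dvd_of_dvd_mul_of_forall_notMem {T : Type u} [CommRing T] [IsNoetherianRing T]
    {k : ℕ} {Q : Fin k → Ideal T} {p : T}
    (hAss : ∀ P ∈ associatedPrimes T (T ⧸ Ideal.span {p}), ∀ x ∈ P, ∃ i, x ∈ Q i)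
    {g : T} (hg : ∀ i, g ∉ Q i) {y : T} (hy : p ∣ y * g) : p ∣ y := by
  by_contra hn
  have hmem : g ∈ {r : T | ∃ x : T ⧸ Ideal.span {p}, x ≠ 0 ∧ r • x = 0} := by
    refine ⟨Ideal.Quotient.mk _ y, ?_, ?_⟩
    · rwa [Ne, Ideal.Quotient.eq_zero_iff_mem, Ideal.mem_span_singleton]
    · rw [Algebra.smul_def, Ideal.Quotient.algebraMap_eq, ← map_mul,
        Ideal.Quotient.eq_zero_iff_mem, Ideal.mem_span_singleton, mul_comm]
      exact hy
  rw [← biUnion_associatedPrimes_eq_zero_divisors] at hmem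
  simp only [Set.mem_iUnion, exists_prop] at hmem
  obtain ⟨P, hP, hgP⟩ := hmem
  obtain ⟨i, hi⟩ := hAss P hP g hgP
  exact hg i hi

open Polynomial in
theorem IsDivClosedAvoiding.divClosure_range_eval₂ {T : Type u} [CommRing T] [IsLocalRing T]
    [IsNoetherianRing T] {k : ℕ} {Q : Fin k → Ideal T} {p : T}
    (hpm : p ∈ IsLocalRing.maximalIdeal T) (hpreg : p ∈ nonZeroDivisors T)
    (hAss : ∀ P ∈ associatedPrimes T (T ⧸ Ideal.span {p}), ∀ x ∈ P, ∃ i, x ∈ Q i)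
    {R : Subring T} (h : IsDivClosedAvoiding Q p R) {t : T}
    (ht : ∀ i, ∀ f : R[X], f.eval₂ R.subtype t ∈ Q i → ∀ n, (f.coeff n : T) ∈ Q i) :
    IsDivClosedAvoiding Q p (divClosure (eval₂RingHom R.subtype t).range) := by
  have hp0 : p ≠ 0 := nonZeroDivisors.ne_zero hpreg
  set π : R := ⟨p, h.p_mem⟩ with hπ
  have hdvd : ∀ r : R, p ∣ (r : T) → π ∣ r := by
    rintro r ⟨s, hs⟩
    have hsR : s ∈ R := h.div_mem s p h.p_mem hp0 (by rw [mul_comm, ← hs]; exact r.2)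
    exact ⟨⟨s, hsR⟩, Subtype.ext hs⟩
  have hC : ∀ i, ∀ f : R[X], f.eval₂ R.subtype t ∈ Q i → C π ∣ f := by
    intro i f hf
    rw [C_dvd_iff_dvd_coeff]
    exact fun n => hdvd _ (h.avoid i _ (f.coeff n).2 (ht i f hf n))
  have hfm : ∀ f : R[X], f ≠ 0 → ∃ m g, f = C π ^ m * g ∧ ¬ C π ∣ g := by
    intro f hf
    obtain ⟨n, hn⟩ : ∃ n, f.coeff n ≠ 0 := by
      by_contra! hh
      exact hf (Polynomial.ext hh)
    have hfin : FiniteMultiplicity (C π) f := by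
      obtain ⟨m, hm⟩ := finiteMultiplicity_of_mem_maximalIdeal hpm
        (x := (f.coeff n : T)) (by simpa using hn)
      refine ⟨m, fun hd => hm ?_⟩
      rw [← C_pow, C_dvd_iff_dvd_coeff] at hd
      simpa [hπ] using map_dvd R.subtype (hd n)
    obtain ⟨g, hg⟩ := hfin.exists_eq_pow_mul_and_not_dvd
    exact ⟨_, g, hg⟩
  have hevalC : ∀ m (g : R[X]), (C π ^ m * g).eval₂ R.subtype t = p ^ m * g.eval₂ R.subtype t := by
    intro m g
    rw [eval₂_mul, eval₂_pow, eval₂_C]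
    rfl
  have hmodp : ∀ g : R[X], ¬ C π ∣ g → ∀ y, p ∣ y * g.eval₂ R.subtype t → p ∣ y :=
    fun g hg y hy => dvd_of_dvd_mul_of_forall_notMem hAss (fun i hi => hg (hC i g hi)) hy
  have hreg1 : ∀ g : R[X], ¬ C π ∣ g → g.eval₂ R.subtype t ∈ nonZeroDivisors T := by
    intro g hg
    rw [mem_nonZeroDivisors_iff_right]
    intro y hy
    by_contra hy0
    obtain ⟨z, hz, hpz⟩ :=
      (finiteMultiplicity_of_mem_maximalIdeal hpm hy0).exists_eq_pow_mul_and_not_dvd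
    rw [hz, mul_assoc, mul_left_mem_nonZeroDivisors_eq_zero_iff (pow_mem hpreg _)] at hy
    exact hpz (hmodp g hg z (hy ▸ dvd_zero p))
  refine isDivClosedAvoiding_divClosure ⟨C π, ?_⟩ ?_ ?_
  · simp [hπ]
  · rintro _ ⟨f, rfl⟩ hf0
    have hf : f ≠ 0 := by
      rintro rfl
      exact hf0 (map_zero _)
    obtain ⟨m, g, rfl, hg⟩ := hfm f hf
    rw [coe_eval₂RingHom, hevalC]
    exact mul_mem (pow_mem hpreg _) (hreg1 g hg)
  · rintro i q hq _ ⟨f, rfl⟩ hf0 ⟨g, hqg⟩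
    have hf : f ≠ 0 := by
      rintro rfl
      exact hf0 (map_zero _)
    obtain ⟨m, f, rfl, hfπ⟩ := hfm f hf
    rw [coe_eval₂RingHom, hevalC] at hqg
    clear hf hf0
    induction m generalizing g with
    | zero =>
      have hg : C π ∣ g := by
        refine hC i g ?_
        rw [hqg]
        exact Ideal.mul_mem_right _ _ hq
      obtain ⟨g', rfl⟩ := hg
      refine hmodp f hfπ q ?_
      have h1 := hevalC 1 g'
      rw [pow_one, pow_one] at h1
      rw [pow_zero, one_mul, h1] at hqg
      exact ⟨_, hqg.symm⟩
    | succ m ih =>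
      have hg : C π ∣ g := by
        refine hC i g ?_
        rw [hqg]
        exact Ideal.mul_mem_right _ _ hq
      obtain ⟨g', rfl⟩ := hg
      refine ih g' ?_
      have h1 := hevalC 1 g'
      rw [pow_one, pow_one] at h1
      rw [h1] at hqg
      refine (mul_cancel_left_mem_nonZeroDivisors hpreg).mp ?_
      rw [hqg]
      ring

open Polynomial in
theorem Gamma_range_eval₂_le {T : Type u} [CommRing T] (R : Subring T) (t : T) :
    Gamma (eval₂RingHom R.subtype t).range ≤ Gamma R :=
  max_le ((Cardinal.mk_le_of_surjective (RingHom.rangeRestrict_surjective _)).trans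
    Polynomial.cardinalMk_le_max) (le_max_right _ _)

open Polynomial in
theorem exists_forall_coeff_mem_of_eval₂_quotient {T : Type u} [CommRing T] {P : Ideal T}
    (hP : P.IsPrime) {R : Subring T} (hcard : Gamma R < Cardinal.mk (T ⧸ P)) (t : T) {b : T}
    (hb : b ∉ P) : ∃ v : T, ∀ f : R[X],
      f.eval₂ ((Ideal.Quotient.mk P).comp R.subtype) (Ideal.Quotient.mk P (t - b * v)) = 0 →
      ∀ n, (f.coeff n : T) ∈ P := by
  set φ := (Ideal.Quotient.mk P).comp R.subtype with hφ
  have : Module.IsTorsionFree φ.range (T ⧸ P) :=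
    Module.isTorsionFree_iff_algebraMap_injective.mpr Subtype.val_injective
  have hle : Cardinal.mk {x : T ⧸ P // IsAlgebraic φ.range x} ≤ Gamma R :=
    (Algebraic.cardinalMk_le_max φ.range (T ⧸ P)).trans
      (max_le_max (Cardinal.mk_le_of_surjective φ.rangeRestrict_surjective) le_rfl)
  obtain ⟨v, hv⟩ : ∃ v : T, Transcendental φ.range (Ideal.Quotient.mk P (t - b * v)) := by
    by_contra! hall
    have halg : ∀ v : T ⧸ P,
        IsAlgebraic φ.range (Ideal.Quotient.mk P t - Ideal.Quotient.mk P b * v) := by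
      intro v
      obtain ⟨v, rfl⟩ := Ideal.Quotient.mk_surjective v
      simpa [Transcendental] using hall v
    have hb' : Ideal.Quotient.mk P b ≠ 0 := fun h => hb (Ideal.Quotient.eq_zero_iff_mem.mp h)
    have hinj : Function.Injective fun v =>
        (⟨_, halg v⟩ : {x : T ⧸ P // IsAlgebraic φ.range x}) := by
      intro v w hvw
      have h1 := congrArg Subtype.val hvw
      exact mul_left_cancel₀ hb' (sub_right_injective h1)
    exact absurd (Cardinal.mk_le_of_injective hinj) (hle.trans_lt hcard).not_ge
  refine ⟨v, fun f hf n => ?_⟩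
  have h1 : aeval (Ideal.Quotient.mk P (t - b * v)) (f.map φ.rangeRestrict) = 0 := by
    rw [aeval_def, eval₂_map]
    exact hf
  have h2 := congrArg (fun g => ((g.coeff n : φ.range) : T ⧸ P))
    ((transcendental_iff.mp hv) _ h1)
  simp only [coeff_map, coeff_zero] at h2
  exact Ideal.Quotient.eq_zero_iff_mem.mp h2

open Polynomial in
theorem exists_forall_coeff_mem_of_eval₂_sub_mul {T : Type u} [CommRing T]
    {C : Finset (Ideal T)} (hprime : ∀ P ∈ C, P.IsPrime)
    (hinc : ∀ P ∈ C, ∀ P' ∈ C, P ≤ P' → P = P')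
    {R : Subring T} (hcard : ∀ P ∈ C, Gamma R < Cardinal.mk (T ⧸ P)) (t : T) {a : T}
    (ha : ∀ P ∈ C, a ∉ P) : ∃ u : T, ∀ P ∈ C, ∀ f : R[X],
      f.eval₂ R.subtype (t - a * u) ∈ P → ∀ n, (f.coeff n : T) ∈ P := by
  classical
  have hex : ∀ P ∈ C, ∃ e, e ∉ P ∧ ∀ P' ∈ C, P' ≠ P → e ∈ P' := by
    intro P hP
    have hnot : ¬ ∏ P' ∈ C.erase P, P' ≤ P := by
      rw [(hprime P hP).prod_le]
      rintro ⟨P', hP', hle⟩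
      exact (Finset.mem_erase.mp hP').1 (hinc P' (Finset.mem_erase.mp hP').2 P hP hle)
    obtain ⟨e, he, hei⟩ := SetLike.not_le_iff_exists.mp hnot
    refine ⟨e, hei, fun P' hP' hne => ?_⟩
    exact (Ideal.prod_le_inf.trans
      (Finset.inf_le (Finset.mem_erase.mpr ⟨hne, hP'⟩))) he
  choose! e he he' using hex
  have hv : ∀ P ∈ C, ∃ v : T, ∀ f : R[X],
      f.eval₂ ((Ideal.Quotient.mk P).comp R.subtype)
        (Ideal.Quotient.mk P (t - a * e P * v)) = 0 → ∀ n, (f.coeff n : T) ∈ P :=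
    fun P hP => exists_forall_coeff_mem_of_eval₂_quotient (hprime P hP) (hcard P hP) t
      fun h => ((hprime P hP).mem_or_mem h).elim (ha P hP) (he P hP)
  choose! v hv using hv
  refine ⟨∑ P ∈ C, e P * v P, fun P hP f hf => hv P hP f ?_⟩
  have hcongr : Ideal.Quotient.mk P (t - a * e P * v P) =
      Ideal.Quotient.mk P (t - a * ∑ P ∈ C, e P * v P) := by
    rw [Ideal.Quotient.eq, ← Finset.add_sum_erase C _ hP]
    have : t - a * e P * v P - (t - a * (e P * v P + ∑ P' ∈ C.erase P, e P' * v P')) =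
        a * ∑ P' ∈ C.erase P, e P' * v P' := by ring
    rw [this]
    refine Ideal.mul_mem_left _ _ (Ideal.sum_mem _ fun P' hP' => ?_)
    rw [Finset.mem_erase] at hP'
    exact Ideal.mul_mem_right _ _ (he' P' hP'.2 P hP hP'.1.symm)
  rw [hcongr, ← hom_eval₂]
  exact Ideal.Quotient.eq_zero_iff_mem.mpr hf

/-- The hypotheses under which transcendental elements can be adjoined to subrings of `T`. -/
structure IsAdjoinable {T : Type u} [CommRing T] [IsLocalRing T] {k : ℕ}
    (Q : Fin k → Ideal T) (p : T) : Prop where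
  prime : ∀ i, (Q i).IsPrime
  eq_of_le : ∀ i j, Q i ≤ Q j → Q i = Q j
  mem_maximalIdeal : p ∈ IsLocalRing.maximalIdeal T
  regular : p ∈ nonZeroDivisors T
  associatedPrimes : ∀ P ∈ associatedPrimes T (T ⧸ Ideal.span {p}), ∀ x ∈ P, ∃ i, x ∈ Q i
  mk_le : ∀ i, Cardinal.mk T ≤ Cardinal.mk (T ⧸ Q i)

open Polynomial in
theorem IsDivClosedAvoiding.exists_sub_mul_mem {T : Type u} [CommRing T] [IsLocalRing T]
    [IsNoetherianRing T] {k : ℕ} {Q : Fin k → Ideal T} {p : T} (hQ : IsAdjoinable Q p)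
    {R : Subring T} (hR : IsDivClosedAvoiding Q p R) (hcard : Gamma R < Cardinal.mk T)
    (t : T) {a : T} (ha : a ∈ R) (hpa : ¬ p ∣ a) :
    ∃ (u : T) (S : Subring T), IsDivClosedAvoiding Q p S ∧ R ≤ S ∧ Gamma S ≤ Gamma R ∧
      t - a * u ∈ S := by
  classical
  obtain ⟨u, hu⟩ := exists_forall_coeff_mem_of_eval₂_sub_mul (C := Finset.univ.image Q)
    (by simpa using hQ.prime)
    (by simpa using hQ.eq_of_le) (R := R)
    (by simpa using fun i => hcard.trans_le (hQ.mk_le i)) t (a := a)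
    (by simpa using fun i hi => hpa (hR.avoid i a ha hi))
  refine ⟨u, divClosure (eval₂RingHom R.subtype (t - a * u)).range,
    hR.divClosure_range_eval₂ hQ.mem_maximalIdeal hQ.regular hQ.associatedPrimes
      fun i => hu (Q i) (Finset.mem_image_of_mem Q (Finset.mem_univ i)), ?_,
    (Gamma_divClosure_le _).trans (Gamma_range_eval₂_le R _), ?_⟩
  · exact fun x hx => le_divClosure _ ⟨C ⟨x, hx⟩, by simp⟩
  · exact le_divClosure _ ⟨X, by simp⟩

theorem exists_eq_pow_mul_of_exists_ne_zero {T : Type u} [CommRing T] [IsLocalRing T]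
    [IsNoetherianRing T] {p : T} (hp : p ∈ IsLocalRing.maximalIdeal T) {ι : Type*}
    (s : Finset ι) (a : ι → T) (ha : ∃ i ∈ s, a i ≠ 0) :
    ∃ (m : ℕ) (b : ι → T), (∀ i ∈ s, a i = b i * p ^ m) ∧ ∃ i ∈ s, ¬ p ∣ b i := by
  classical
  obtain ⟨i, hi, hai⟩ := ha
  have hex : ∃ m, ∃ j ∈ s, ¬ p ^ (m + 1) ∣ a j := by
    obtain ⟨m, hm⟩ := finiteMultiplicity_of_mem_maximalIdeal hp hai
    exact ⟨m, i, hi, hm⟩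
  obtain ⟨j, hj, hja⟩ := Nat.find_spec hex
  have hall : ∀ l ∈ s, p ^ Nat.find hex ∣ a l := by
    rcases hm : Nat.find hex with _ | m
    · simp
    · have := Nat.find_min hex (m := m) (by omega)
      push Not at this
      exact this
  have hb : ∀ l ∈ s, ∃ b, a l = b * p ^ Nat.find hex := fun l hl =>
    (hall l hl).imp fun b hb => by rw [hb, mul_comm]
  choose! b hb using hb
  refine ⟨Nat.find hex, b, hb, j, hj, fun hd => hja ?_⟩
  rw [hb j hj, pow_succ, mul_comm (p ^ _)]
  exact mul_dvd_mul_right hd _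

theorem IsDivClosedAvoiding.exists_sum_eq {T : Type u} [CommRing T] [IsLocalRing T]
    [IsNoetherianRing T] {k : ℕ} {Q : Fin k → Ideal T} {p : T} (hQ : IsAdjoinable Q p)
    {ι : Type*} (s : Finset ι) {R : Subring T} (hR : IsDivClosedAvoiding Q p R)
    (hcard : Gamma R < Cardinal.mk T) {a t : ι → T} (ha : ∀ i ∈ s, a i ∈ R)
    (hc : ∑ i ∈ s, a i * t i ∈ R) :
    ∃ S : Subring T, IsDivClosedAvoiding Q p S ∧ R ≤ S ∧ Gamma S ≤ Gamma R ∧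
      ∃ t' : ι → T, (∀ i ∈ s, t' i ∈ S) ∧ ∑ i ∈ s, a i * t' i = ∑ i ∈ s, a i * t i := by
  classical
  induction hn : s.card generalizing s R a t with
  | zero =>
    rw [Finset.card_eq_zero] at hn
    exact ⟨R, hR, le_rfl, le_rfl, t, by simp [hn], rfl⟩
  | succ n ih =>
    by_cases h0 : ∃ i ∈ s, a i ≠ 0
    swap
    · push Not at h0
      refine ⟨R, hR, le_rfl, le_rfl, 0, fun i _ => R.zero_mem, ?_⟩
      exact Finset.sum_congr rfl fun i hi => by simp [h0 i hi]
    obtain ⟨m, b, hab, j, hj, hbj⟩ :=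
      exists_eq_pow_mul_of_exists_ne_zero hQ.mem_maximalIdeal s a h0
    have hpm : p ^ m ∈ R := R.pow_mem hR.p_mem m
    have hpm0 : p ^ m ≠ 0 := nonZeroDivisors.ne_zero (pow_mem hQ.regular m)
    have hb : ∀ i ∈ s, b i ∈ R := fun i hi =>
      hR.div_mem _ _ hpm hpm0 (hab i hi ▸ ha i hi)
    have hsum : ∀ f : ι → T, ∑ i ∈ s, a i * f i = (∑ i ∈ s, b i * f i) * p ^ m := by
      intro f
      rw [Finset.sum_mul]
      exact Finset.sum_congr rfl fun i hi => by rw [hab i hi]; ring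
    have hc' : ∑ i ∈ s, b i * t i ∈ R :=
      hR.div_mem _ _ hpm hpm0 (hsum t ▸ hc)
    simp only [hsum]
    by_cases hl : ∃ l ∈ s, l ≠ j
    · obtain ⟨l, hl, hlj⟩ := hl
      obtain ⟨u, S, hS, hRS, hcS, huS⟩ := hR.exists_sub_mul_mem hQ hcard (t l) (hb j hj) hbj
      have hjl : j ∈ s.erase l := Finset.mem_erase.mpr ⟨hlj.symm, hj⟩
      have hsplit : ∑ i ∈ s.erase l, b i * Function.update t j (t j + b l * u) i =
          ∑ i ∈ s, b i * t i - b l * (t l - b j * u) := by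
        rw [← Finset.add_sum_erase s _ hl, ← Finset.add_sum_erase _ _ hjl,
          ← Finset.add_sum_erase _ (fun i => b i * t i) hjl, Function.update_self]
        rw [Finset.sum_congr rfl fun i hi => by
          rw [Function.update_of_ne (Finset.mem_erase.mp hi).1]]
        ring
      obtain ⟨S', hS', hSS', hcS', t', ht', he⟩ := ih (s.erase l) hS (hcS.trans_lt hcard)
        (a := b) (t := Function.update t j (t j + b l * u))
        (fun i hi => hRS (hb i (Finset.mem_of_mem_erase hi)))
        (by rw [hsplit]; exact S.sub_mem (hRS hc') (S.mul_mem (hRS (hb l hl)) huS))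
        (by rw [Finset.card_erase_of_mem hl, hn]; rfl)
      refine ⟨S', hS', hRS.trans hSS', hcS'.trans hcS,
        Function.update t' l (t l - b j * u), ?_, ?_⟩
      · intro i hi
        by_cases hil : i = l
        · subst hil
          rw [Function.update_self]
          exact hSS' huS
        · rw [Function.update_of_ne hil]
          exact ht' i (Finset.mem_erase.mpr ⟨hil, hi⟩)
      · congr 1
        rw [← Finset.add_sum_erase s _ hl, Function.update_self]
        rw [Finset.sum_congr rfl fun i hi => by
          rw [Function.update_of_ne (Finset.mem_erase.mp hi).1], he, hsplit]
        ring
    · push Not at hl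
      obtain rfl : s = {j} := Finset.eq_singleton_iff_unique_mem.mpr ⟨hj, hl⟩
      refine ⟨R, hR, le_rfl, le_rfl, t, fun i hi => ?_, rfl⟩
      rw [Finset.mem_singleton] at hi
      subst hi
      rw [Finset.sum_singleton, mul_comm] at hc'
      exact hR.div_mem _ _ (hb i hj) (fun h => hbj (h ▸ dvd_zero p)) hc'

/-- **Lemma 8.** Ideal-membership lemma: given a `p`ca subring `R` with `pT ∩ R = pR`, a
finitely generated ideal `I` of `R` and `c ∈ IT ∩ R`, there is a `p`ca subring `S ⊇ R`
with `Γ(S) = Γ(R)`, `c ∈ IS` and `pT ∩ S = pS`. -/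
theorem statement5
    {T : Type u} [CommRing T] [IsLocalRing T] [IsNoetherianRing T]
    [IsAdicComplete (IsLocalRing.maximalIdeal T) T]
    {k : ℕ} (hk : 0 < k) (Q : Fin k → Ideal T)
    (hQprime : ∀ i, (Q i).IsPrime)
    (hQnonmax : ∀ i, Q i ≠ IsLocalRing.maximalIdeal T)
    (hQinc : ∀ i j, Q i ≤ Q j → Q i = Q j)
    (p : T) (hp0 : p ≠ 0) (hpreg : p ∈ nonZeroDivisors T) (hpQ : ∀ i, p ∈ Q i)
    (hdim : 1 ≤ ringKrullDim T)
    (hAss : ∀ P ∈ associatedPrimes T (T ⧸ Ideal.span {p}), ∀ x ∈ P, ∃ i, x ∈ Q i)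
    (R : Subring T) (hR : IsPcaSubring Q p R)
    (hpR : ∀ x ∈ R, x ∈ Ideal.span {p} ↔ ∃ r ∈ R, x = p * r)
    (I : Ideal ↥R) (hIfg : I.FG) (c : ↥R) (hc : (c : T) ∈ I.map R.subtype) :
    ∃ S : Subring T, IsPcaSubring Q p S ∧ ∃ hRS : R ≤ S,
      Gamma ↥S = Gamma ↥R ∧
      Subring.inclusion hRS c ∈ I.map (Subring.inclusion hRS) ∧
      (∀ x ∈ S, x ∈ Ideal.span {p} ↔ ∃ s ∈ S, x = p * s) := by
  have hpm : p ∈ IsLocalRing.maximalIdeal T :=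
    IsLocalRing.le_maximalIdeal (hQprime ⟨0, hk⟩).ne_top (hpQ ⟨0, hk⟩)
  have hadj : IsAdjoinable Q p := ⟨hQprime, hQinc, hpm, hpreg, hAss, fun i =>
    mk_le_mk_residue_pow_aleph0.trans
      (mk_residue_pow_aleph0_le_mk_quotient (Q i) (hQprime i) (hQnonmax i))⟩
  obtain ⟨n, a, rfl⟩ := Submodule.fg_iff_exists_fin_generating_family.mp hIfg
  have hc' : (c : T) ∈ Ideal.span (Set.range fun i => (a i : T)) := by
    rw [← Ideal.span, Ideal.map_span, ← Set.range_comp] at hc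
    exact hc
  obtain ⟨t, ht⟩ := Ideal.mem_span_range_iff_exists_fun.mp hc'
  have ht' : ∑ i, (a i : T) * t i = c := by rw [← ht]; simp [mul_comm]
  obtain ⟨S, hS, hRS, hcS, s, hs, hsc⟩ :=
    hR.isDivClosedAvoiding_divClosure.exists_sum_eq hadj Finset.univ
      ((Gamma_divClosure_le R).trans_lt hR.2.2.1) (a := fun i => (a i : T)) (t := t)
      (fun i _ => le_divClosure R (a i).2) (ht' ▸ le_divClosure R c.2)
  have hRS' : R ≤ S := (le_divClosure R).trans hRS
  have hΓ : Gamma S ≤ Gamma R := hcS.trans (Gamma_divClosure_le R)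
  refine ⟨S, hS.isPcaSubring (hΓ.trans_lt hR.2.2.1), hRS', le_antisymm hΓ ?_, ?_, ?_⟩
  · exact max_le_max (Cardinal.mk_le_of_injective (Subring.inclusion_injective hRS')) le_rfl
  · have he : Subring.inclusion hRS' c =
        ∑ i, Subring.inclusion hRS' (a i) * ⟨s i, hs i (Finset.mem_univ i)⟩ := by
      refine Subtype.ext ?_
      rw [ht'] at hsc
      simpa using hsc.symm
    rw [he]
    refine Ideal.sum_mem _ fun i _ => Ideal.mul_mem_right _ _ (Ideal.mem_map_of_mem _ ?_)
    exact Submodule.subset_span ⟨i, rfl⟩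
  · intro x hx
    rw [Ideal.mem_span_singleton]
    constructor
    · rintro ⟨y, rfl⟩
      exact ⟨y, hS.div_mem y p hS.p_mem hp0 (by rwa [mul_comm]), rfl⟩
    · rintro ⟨y, -, rfl⟩
      exact dvd_mul_right p y
end

section
/- Suppose dim T ≥ 1 and every associated prime P of the T-module T/pT satisfies P ⊆ ⋃_{i=1}^k Qᵢ. Let Π denote the prime subring of T, and suppose ((Qᵢ \ pT)Π[p]) ∩ Π[p] = {0} for all i ∈ {1, …, k} and P ∩ Π[p] = (0) for all associated primes P of T. Then there exists a local (Noetherian quasilocal) domain A ⊆ T such that: (1) p ∈ A; (2) the inclusion A ⊆ T induces an isomorphism of the (A ∩ 𝔪)-adic completion of A with T; (3) pA is a prime ideal of A, Qᵢ ∩ A = pA for every i, and every prime ideal Q of T with Q ∩ A = pA satisfies Q ⊆ Qᵢ for some i ∈ {1, …, k}; and (4) if J is an ideal of T satisfying J ⊄ Qᵢ for all i ∈ {1, …, k}, then the canonical map A → T/J is onto and J ∩ A ⊄ Qᵢ for all i ∈ {1, …, k}. -/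
universe u

section Factorable

variable {T : Type u} [CommRing T] {k : ℕ}

/-- Every nonzero element of `R` is a power of `p` times an element outside all the `Q i`. -/
def IsFactorable (Q : Fin k → Ideal T) (p : T) (R : Subring T) : Prop :=
  ∀ r ∈ R, r ≠ 0 → ∃ (n : ℕ) (t : T), r = p ^ n * t ∧ ∀ i, t ∉ Q i

/-- The elements of `T` that are fractions of elements of `R` with denominator regular in `T`. -/
def fracClosure (R : Subring T) : Subring T where
  carrier := {s | ∃ a ∈ R, a ∈ nonZeroDivisors T ∧ a * s ∈ R}
  mul_mem' := by
    rintro s t ⟨a, ha, ha', has⟩ ⟨b, hb, hb', hbt⟩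
    exact ⟨a * b, mul_mem ha hb, mul_mem ha' hb', by convert mul_mem has hbt using 1; ring⟩
  one_mem' := ⟨1, one_mem _, one_mem _, by simp⟩
  add_mem' := by
    rintro s t ⟨a, ha, ha', has⟩ ⟨b, hb, hb', hbt⟩
    exact ⟨a * b, mul_mem ha hb, mul_mem ha' hb', by
      convert add_mem (mul_mem hb has) (mul_mem ha hbt) using 1; ring⟩
  zero_mem' := ⟨1, one_mem _, one_mem _, by simp⟩
  neg_mem' := by
    rintro s ⟨a, ha, ha', has⟩
    exact ⟨a, ha, ha', by convert neg_mem has using 1; ring⟩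

lemma mem_fracClosure {R : Subring T} {s : T} :
    s ∈ fracClosure R ↔ ∃ a ∈ R, a ∈ nonZeroDivisors T ∧ a * s ∈ R := Iff.rfl

lemma le_fracClosure (R : Subring T) : R ≤ fracClosure R :=
  fun r hr => ⟨1, one_mem _, one_mem _, by simpa using hr⟩

lemma fracClosure_mono {R S : Subring T} (h : R ≤ S) : fracClosure R ≤ fracClosure S := by
  rintro s ⟨a, ha, ha', has⟩
  exact ⟨a, h ha, ha', h has⟩

lemma mem_fracClosure_of_mul_mem {R : Subring T} {a s : T} (ha : a ∈ fracClosure R)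
    (ha' : a ∈ nonZeroDivisors T) (has : a * s ∈ fracClosure R) : s ∈ fracClosure R := by
  obtain ⟨b, hb, hb', hba⟩ := ha
  obtain ⟨c, hc, hc', hcs⟩ := has
  exact ⟨c * (b * a), mul_mem hc hba, mul_mem hc' (mul_mem hb' ha'), by
    convert mul_mem hb hcs using 1; ring⟩

lemma pow_dvd_of_pow_dvd_mul {p : T} (hp : p ∈ nonZeroDivisors T) {a : T}
    (ha : ∀ x, p ∣ a * x → p ∣ x) (n : ℕ) {x : T} (h : p ^ n ∣ a * x) : p ^ n ∣ x := by
  induction n generalizing x with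
  | zero => simp
  | succ n ih =>
    obtain ⟨y, hy⟩ := ha x ((dvd_pow_self p n.succ_ne_zero).trans h)
    subst hy
    rw [pow_succ'] at h ⊢
    rw [mul_left_comm] at h
    obtain ⟨z, hz⟩ := h
    rw [mul_assoc, mul_cancel_left_mem_nonZeroDivisors hp] at hz
    exact mul_dvd_mul_left p (ih ⟨z, hz⟩)

lemma IsFactorable.fracClosure [Nontrivial T] {Q : Fin k → Ideal T} {p : T} {R : Subring T}
    (hk : 0 < k) (hp : p ∈ nonZeroDivisors T) (hpQ : ∀ i, p ∈ Q i)
    (hreg : ∀ z, (∀ i, z ∉ Q i) → ∀ x, p ∣ z * x → p ∣ x)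
    (hR : IsFactorable Q p R) : IsFactorable Q p (fracClosure R) := by
  rintro s ⟨a, ha, ha', has⟩ hs
  have ha0 : a ≠ 0 := nonZeroDivisors.ne_zero ha'
  have has0 : a * s ≠ 0 := fun h => hs ((mul_right_mem_nonZeroDivisors_eq_zero_iff ha').1
    (by rwa [mul_comm] at h))
  obtain ⟨e, a₁, rfl, ha₁⟩ := hR a ha ha0
  obtain ⟨f, c₁, hc, hc₁⟩ := hR _ has has0
  rcases le_or_gt e f with hef | hef
  · obtain ⟨d, rfl⟩ := Nat.exists_eq_add_of_le hef
    rw [pow_add, mul_assoc, mul_assoc, mul_cancel_left_mem_nonZeroDivisors (pow_mem hp e)] at hc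
    obtain ⟨t, rfl⟩ := pow_dvd_of_pow_dvd_mul hp (hreg a₁ ha₁) d ⟨_, hc⟩
    rw [mul_left_comm, mul_cancel_left_mem_nonZeroDivisors (pow_mem hp d)] at hc
    exact ⟨d, t, rfl, fun i hi => hc₁ i (hc ▸ (Q i).mul_mem_left _ hi)⟩
  · obtain ⟨d, rfl⟩ := Nat.exists_eq_add_of_lt hef
    rw [add_assoc, pow_add, mul_assoc, mul_assoc,
      mul_cancel_left_mem_nonZeroDivisors (pow_mem hp f)] at hc
    refine absurd ?_ (hc₁ ⟨0, hk⟩)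
    rw [← hc, pow_succ', mul_assoc]
    exact (Q _).mul_mem_right _ (hpQ _)

lemma mem_nonZeroDivisors_of_regular_mod [IsLocalRing T] [IsNoetherianRing T] {p : T}
    (hp : p ∈ nonZeroDivisors T) (hpm : p ∈ IsLocalRing.maximalIdeal T) {a : T}
    (ha : ∀ x, p ∣ a * x → p ∣ x) : a ∈ nonZeroDivisors T := by
  rw [mem_nonZeroDivisors_iff_right]
  intro x hx
  have h : x ∈ ⨅ n : ℕ, Ideal.span {p} ^ n := by
    refine Ideal.mem_iInf.2 fun n => ?_
    rw [Ideal.span_singleton_pow, Ideal.mem_span_singleton]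
    exact pow_dvd_of_pow_dvd_mul hp ha n (by rw [mul_comm, hx]; exact dvd_zero _)
  rwa [Ideal.iInf_pow_eq_bot_of_isLocalRing, Ideal.mem_bot] at h
  exact Ideal.span_singleton_ne_top hpm

lemma IsFactorable.mem_nonZeroDivisors [IsLocalRing T] [IsNoetherianRing T]
    {Q : Fin k → Ideal T} {p : T} {R : Subring T}
    (hp : p ∈ nonZeroDivisors T) (hpm : p ∈ IsLocalRing.maximalIdeal T)
    (hreg : ∀ z, (∀ i, z ∉ Q i) → ∀ x, p ∣ z * x → p ∣ x)
    (hR : IsFactorable Q p R) {r : T} (hr : r ∈ R) (hr0 : r ≠ 0) : r ∈ nonZeroDivisors T := by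
  obtain ⟨n, t, rfl, ht⟩ := hR r hr hr0
  exact mul_mem (pow_mem hp n) (mem_nonZeroDivisors_of_regular_mod hp hpm (hreg t ht))

/-- `y` is, modulo each `Q i`, not a root of a polynomial over `R` that is nonzero
modulo `Q i`. -/
def IsGeneric (Q : Fin k → Ideal T) (R : Subring T) (y : T) : Prop :=
  ∀ i, ∀ g : Polynomial R, (∃ n, (g.coeff n : T) ∉ Q i) → Polynomial.aeval y g ∉ Q i

lemma IsGeneric.mono {Q : Fin k → Ideal T} {R S : Subring T} {y : T}
    (hS : IsGeneric Q S y) (h : R ≤ S) : IsGeneric Q R y := by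
  rintro i g ⟨n, hn⟩
  have := hS i (g.map (Subring.inclusion h)) ⟨n, by simpa using hn⟩
  rw [Polynomial.aeval_def, Polynomial.eval₂_map] at this
  exact this

lemma IsFactorable.closure_insert [Nontrivial T] {Q : Fin k → Ideal T} {p : T} {s : Set T}
    (hk : 0 < k) (hp : p ∈ nonZeroDivisors T) (hpQ : ∀ i, p ∈ Q i) (hps : p ∈ s)
    (hreg : ∀ z, (∀ i, z ∉ Q i) → ∀ x, p ∣ z * x → p ∣ x)
    (hs : IsFactorable Q p (Subring.closure s)) {y : T}
    (hy : IsGeneric Q (_root_.fracClosure (Subring.closure s)) y) :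
    IsFactorable Q p (Subring.closure (insert y s)) := by
  set R := _root_.fracClosure (Subring.closure s)
  have hR : IsFactorable Q p R := hs.fracClosure hk hp hpQ hreg
  have hpR : p ∈ R := le_fracClosure _ (Subring.subset_closure hps)
  have hle : Subring.closure (insert y s) ≤ (Polynomial.aeval (R := R) y).toRingHom.range := by
    rw [Subring.closure_le]
    rintro z (rfl | hz)
    · exact ⟨Polynomial.X, by simp⟩
    · exact ⟨Polynomial.C ⟨z, le_fracClosure _ (Subring.subset_closure hz)⟩, Polynomial.aeval_C _ _⟩
  intro r hr hr0
  obtain ⟨g, rfl⟩ := hle hr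
  simp only [AlgHom.toRingHom_eq_coe, RingHom.coe_coe] at hr0 ⊢
  have hnd : ∀ c : R, (∀ i, (c : T) ∉ Q i) → ¬ (⟨p, hpR⟩ : R) ∣ c := by
    rintro c hc ⟨d, rfl⟩
    exact hc ⟨0, hk⟩ ((Q _).mul_mem_right _ (hpQ _))
  have hfac : ∀ c : R, c ≠ 0 → ∃ (n : ℕ) (d : R), c = ⟨p, hpR⟩ ^ n * d ∧ ∀ i, (d : T) ∉ Q i := by
    intro c hc
    obtain ⟨n, t, hct, ht⟩ := hR c c.2 (by simpa using hc)
    have htR : t ∈ R := mem_fracClosure_of_mul_mem (pow_mem hpR n) (pow_mem hp n) (hct ▸ c.2)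
    exact ⟨n, ⟨t, htR⟩, Subtype.ext hct, ht⟩
  have hg0 : g ≠ 0 := by rintro rfl; simp at hr0
  have hfin : FiniteMultiplicity (Polynomial.C (⟨p, hpR⟩ : R)) g := by
    obtain ⟨m, hm⟩ : ∃ m, g.coeff m ≠ 0 := by
      by_contra! h
      exact hg0 (Polynomial.ext fun m => by simp [h m])
    obtain ⟨n, d, hd, hdQ⟩ := hfac _ hm
    refine ⟨n, fun hdvd => ?_⟩
    rw [← Polynomial.C_pow, Polynomial.C_dvd_iff_dvd_coeff] at hdvd
    obtain ⟨z, hz⟩ := hdvd m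
    refine hnd d hdQ ⟨z, ?_⟩
    rw [hd, pow_succ, mul_assoc] at hz
    have hz' := congrArg Subtype.val hz
    simp only [Subring.coe_mul, Subring.coe_pow] at hz'
    rw [mul_cancel_left_mem_nonZeroDivisors (pow_mem hp n)] at hz'
    exact Subtype.ext hz'
  obtain ⟨g₁, hg₁, hg₁'⟩ := hfin.exists_eq_pow_mul_and_not_dvd
  rw [Polynomial.C_dvd_iff_dvd_coeff] at hg₁'
  push Not at hg₁'
  obtain ⟨m, hm⟩ := hg₁'
  obtain ⟨n, d, hd, hdQ⟩ := hfac (g₁.coeff m) (fun h => hm (h ▸ dvd_zero _))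
  have hn : n = 0 := by
    by_contra hn
    exact hm (hd ▸ (dvd_pow_self _ hn).mul_right _)
  subst hn
  refine ⟨multiplicity (Polynomial.C ⟨p, hpR⟩) g, Polynomial.aeval y g₁, ?_,
    fun i => hy i g₁ ⟨m, ?_⟩⟩
  · conv_lhs => rw [hg₁]
    rw [map_mul, map_pow, Polynomial.aeval_C]
    rfl
  · rw [hd]; simpa using hdQ i

end Factorable

section Cardinality

open Cardinal

lemma Subring.cardinalMk_closure_le_max {T : Type u} [CommRing T] (s : Set T) :
    #(Subring.closure s) ≤ max #s ℵ₀ := by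
  have h := Algebra.lift_cardinalMk_adjoin_le ℤ s
  rw [lift_uzero, mk_int, lift_aleph0, lift_uzero] at h
  have e : #(Subring.closure s) = #(Algebra.adjoin ℤ s) := by
    rw [Algebra.adjoin_int]; rfl
  rw [e]
  refine h.trans ?_
  rw [max_assoc]
  simp

lemma cardinalMk_fracClosure_le {T : Type u} [CommRing T] (R : Subring T) :
    #(fracClosure R) ≤ max #R ℵ₀ := by
  choose a ha ha' has using fun s : fracClosure R => mem_fracClosure.1 s.2
  have hinj : Function.Injective
      (fun s : fracClosure R => ((⟨a s, ha s⟩, ⟨a s * s, has s⟩) : R × R)) := by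
    intro s t hst
    simp only [Prod.mk.injEq, Subtype.mk.injEq] at hst
    obtain ⟨h₁, h₂⟩ := hst
    rw [h₁, mul_cancel_left_mem_nonZeroDivisors (ha' t)] at h₂
    exact Subtype.ext h₂
  refine (mk_le_of_injective hinj).trans ?_
  rw [← mul_def]
  exact (mul_le_max _ _).trans (by simp)

end Cardinality

section CompleteLocal

open Cardinal IsLocalRing

variable {T : Type u} [CommRing T] [IsLocalRing T]

lemma cardinalMk_quotient_maximalIdeal_pow_le [IsNoetherianRing T] (n : ℕ) :
    #(T ⧸ maximalIdeal T ^ n) ≤ #(ResidueField T) ^ ℵ₀ := by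
  induction n with
  | zero =>
    have : Subsingleton (T ⧸ maximalIdeal T ^ 0) := by
      rw [pow_zero, Ideal.one_eq_top]; infer_instance
    exact (le_one_iff_subsingleton.2 this).trans
      (Cardinal.one_le_iff_ne_zero.2 (power_ne_zero _ (mk_ne_zero _)))
  | succ n ih =>
    obtain ⟨d, g, hg⟩ := Submodule.fg_iff_exists_fin_generating_family.1
      (IsNoetherian.noetherian (maximalIdeal T))
    let F : ResidueField T × (Fin d → T ⧸ maximalIdeal T ^ n) → T ⧸ maximalIdeal T ^ (n + 1) :=
      fun c => Ideal.Quotient.mk _ (Function.surjInv residue_surjective c.1 +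
        ∑ i, Function.surjInv Ideal.Quotient.mk_surjective (c.2 i) * g i)
    have hF : Function.Surjective F := by
      intro q
      obtain ⟨t, rfl⟩ := Ideal.Quotient.mk_surjective q
      have ht : t - Function.surjInv residue_surjective (residue T t) ∈ maximalIdeal T := by
        rw [← residue_eq_zero_iff, map_sub, Function.surjInv_eq residue_surjective, sub_self]
      rw [← hg, Submodule.mem_span_range_iff_exists_fun] at ht
      obtain ⟨c, hc⟩ := ht
      refine ⟨(residue T t, fun i => Ideal.Quotient.mk _ (c i)), ?_⟩
      rw [Ideal.Quotient.mk_eq_mk_iff_sub_mem]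
      have : Function.surjInv residue_surjective (residue T t) +
          ∑ i, Function.surjInv Ideal.Quotient.mk_surjective
            (Ideal.Quotient.mk (maximalIdeal T ^ n) (c i)) * g i - t =
          ∑ i, (Function.surjInv Ideal.Quotient.mk_surjective
            (Ideal.Quotient.mk (maximalIdeal T ^ n) (c i)) - c i) * g i := by
        simp only [sub_mul, Finset.sum_sub_distrib]
        simp only [smul_eq_mul] at hc
        rw [hc]; ring
      rw [this, pow_succ]
      refine Ideal.sum_mem _ fun i _ => Ideal.mul_mem_mul ?_ ?_
      · rw [← Ideal.Quotient.mk_eq_mk_iff_sub_mem, Function.surjInv_eq Ideal.Quotient.mk_surjective]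
      · rw [← hg]; exact Submodule.subset_span ⟨i, rfl⟩
    calc #(T ⧸ maximalIdeal T ^ (n + 1))
        ≤ #(ResidueField T) * #(T ⧸ maximalIdeal T ^ n) ^ (d : Cardinal) := by
          refine (mk_le_of_surjective hF).trans_eq ?_
          simp
      _ ≤ #(ResidueField T) ^ ℵ₀ * (#(ResidueField T) ^ ℵ₀) ^ (ℵ₀ : Cardinal.{u}) := by
          refine mul_le_mul' (self_le_power _ one_le_aleph0) ?_
          exact (power_le_power_right ih).trans (power_le_power_left
            (power_ne_zero _ (mk_ne_zero _)) natCast_lt_aleph0.le)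
      _ = #(ResidueField T) ^ ℵ₀ := by
          rw [← power_mul, ← power_add, aleph0_mul_aleph0, aleph0_add_aleph0]

lemma cardinalMk_le_residueField_power [IsNoetherianRing T]
    [IsHausdorff (maximalIdeal T) T] : #T ≤ #(ResidueField T) ^ ℵ₀ := by
  have hinj : Function.Injective
      (fun (t : T) (n : ℕ) => Ideal.Quotient.mk (maximalIdeal T ^ n) t) := by
    intro s t hst
    rw [IsHausdorff.eq_iff_smodEq (I := maximalIdeal T)]
    intro n
    rw [SModEq.sub_mem, smul_eq_mul, Ideal.mul_top, ← Ideal.Quotient.mk_eq_mk_iff_sub_mem]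
    exact congrFun hst n
  refine (mk_le_of_injective hinj).trans ?_
  have h := prod_le_prod (fun n : ℕ => #(T ⧸ maximalIdeal T ^ n))
    (fun _ => #(ResidueField T) ^ ℵ₀) cardinalMk_quotient_maximalIdeal_pow_le
  rw [mk_pi]
  refine h.trans_eq ?_
  rw [prod_const, lift_uzero, mk_nat, lift_aleph0, ← power_mul, aleph0_mul_aleph0]

lemma exists_powerSeries_value [IsAdicComplete (maximalIdeal T) T] {y : T}
    (hy : y ∈ maximalIdeal T) :
    ∃ L : (ℕ → T) → T, ∀ a, L a = a 0 + y * L (fun n => a (n + 1)) := by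
  have hprec : ∀ a : ℕ → T, ∃ l, ∀ n,
      ∑ i ∈ Finset.range n, a i * y ^ i ≡ l [SMOD (maximalIdeal T ^ n • ⊤ : Submodule T T)] := by
    intro a
    refine IsPrecomplete.prec (inferInstance : IsPrecomplete (maximalIdeal T) T) ?_
    intro m n hmn
    rw [SModEq.comm, SModEq.sub_mem, smul_eq_mul, Ideal.mul_top,
      ← Finset.sum_Ico_eq_sub _ hmn]
    refine Ideal.sum_mem _ fun i hi => Ideal.mul_mem_left _ _ ?_
    exact Ideal.pow_le_pow_right (Finset.mem_Ico.1 hi).1 (Ideal.pow_mem_pow hy i)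
  choose L hL using hprec
  refine ⟨L, fun a => ?_⟩
  rw [IsHausdorff.eq_iff_smodEq (I := maximalIdeal T)]
  intro n
  have h₁ := hL a (n + 1)
  have h₂ := hL (fun n => a (n + 1)) n
  rw [SModEq.sub_mem, smul_eq_mul, Ideal.mul_top] at h₁ h₂ ⊢
  have h₃ := Ideal.pow_le_pow_right n.le_succ h₁
  rw [Finset.sum_range_succ'] at h₃
  have h₄ : ∑ i ∈ Finset.range n, a (i + 1) * y ^ (i + 1) =
      y * ∑ i ∈ Finset.range n, a (i + 1) * y ^ i := by
    rw [Finset.mul_sum]; exact Finset.sum_congr rfl fun i _ => by ring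
  rw [h₄] at h₃
  have := Ideal.sub_mem _ (Ideal.mul_mem_left _ y h₂) h₃
  convert this using 1
  ring

lemma residueField_power_le_cardinalMk_quotient [IsAdicComplete (maximalIdeal T) T]
    {P : Ideal T} (hP : P.IsPrime) (hPm : P ≠ maximalIdeal T) :
    #(ResidueField T) ^ ℵ₀ ≤ #(T ⧸ P) := by
  have hle : P ≤ maximalIdeal T := le_maximalIdeal hP.ne_top
  obtain ⟨y, hy, hyP⟩ := SetLike.exists_of_lt (lt_of_le_of_ne hle hPm)
  obtain ⟨L, hL⟩ := exists_powerSeries_value hy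
  let s : ResidueField T → T := Function.surjInv residue_surjective
  have hs : ∀ c, residue T (s c) = c := Function.surjInv_eq _
  have key : ∀ n (a b : ℕ → ResidueField T), L (s ∘ a) - L (s ∘ b) ∈ P → a n = b n := by
    have h0 : ∀ a b : ℕ → ResidueField T, L (s ∘ a) - L (s ∘ b) ∈ P → a 0 = b 0 := by
      intro a b hab
      have := hle hab
      rw [← residue_eq_zero_iff, hL, hL (s ∘ b), map_sub, map_add, map_add, map_mul, map_mul,
        (residue_eq_zero_iff y).2 hy] at this
      simpa [hs, sub_eq_zero] using this
    intro n
    induction n with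
    | zero => exact h0
    | succ n ih =>
      intro a b hab
      refine ih (fun n => a (n + 1)) (fun n => b (n + 1)) ?_
      have h := h0 a b hab
      rw [hL, hL (s ∘ b)] at hab
      simp only [Function.comp_apply, h, add_sub_add_left_eq_sub, ← mul_sub] at hab
      exact (hP.mem_or_mem hab).resolve_left hyP
  have hinj : Function.Injective
      (fun a : ℕ → ResidueField T => Ideal.Quotient.mk P (L (s ∘ a))) := by
    intro a b hab
    exact funext fun n => key n a b (Ideal.Quotient.mk_eq_mk_iff_sub_mem _ _ |>.1 hab)
  simpa using mk_le_of_injective hinj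

lemma cardinalMk_le_cardinalMk_quotient [IsNoetherianRing T] [IsAdicComplete (maximalIdeal T) T]
    {P : Ideal T} (hP : P.IsPrime) (hPm : P ≠ maximalIdeal T) : #T ≤ #(T ⧸ P) :=
  cardinalMk_le_residueField_power.trans (residueField_power_le_cardinalMk_quotient hP hPm)

lemma aleph0_lt_cardinalMk [IsAdicComplete (maximalIdeal T) T]
    {P : Ideal T} (hP : P.IsPrime) (hPm : P ≠ maximalIdeal T) : ℵ₀ < #T := by
  refine lt_of_lt_of_le ?_ ((residueField_power_le_cardinalMk_quotient hP hPm).trans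
    (mk_le_of_surjective Ideal.Quotient.mk_surjective))
  refine (cantor _).trans_le (power_le_power_right ?_)
  rw [two_le_iff]
  exact exists_pair_ne _

end CompleteLocal

section Generic

open Cardinal

variable {T : Type u} [CommRing T]

lemma exists_dvd_sub_of_cardinalMk_lt {C : Finset (Ideal T)} (hC : ∀ P ∈ C, P.IsPrime)
    (hinc : ∀ P ∈ C, ∀ P' ∈ C, P ≤ P' → P = P') (B : ∀ P : Ideal T, Set (T ⧸ P))
    (hB : ∀ P ∈ C, #(B P) < #(T ⧸ P)) (u : T) {x : T} (hx : ∀ P ∈ C, x ∉ P) :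
    ∃ y, x ∣ y - u ∧ ∀ P ∈ C, Ideal.Quotient.mk P y ∉ B P := by
  classical
  have hz : ∀ P : Ideal T, ∃ z : T, P ∈ C → (∀ P' ∈ C, P' ≠ P → z ∈ P') ∧ z ∉ P := by
    intro P
    by_cases hP : P ∈ C
    · have : ¬ (C.erase P).inf id ≤ P := by
        rw [(hC P hP).inf_le']
        rintro ⟨P', hP', hle⟩
        rw [Finset.mem_erase] at hP'
        exact hP'.1 (hinc P' hP'.2 P hP hle)
      obtain ⟨z, hz, hzP⟩ := SetLike.not_le_iff_exists.1 this
      rw [Submodule.mem_finsetInf] at hz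
      exact ⟨z, fun _ => ⟨fun P' h h' => hz P' (Finset.mem_erase.2 ⟨h', h⟩), hzP⟩⟩
    · exact ⟨0, fun h => absurd h hP⟩
  choose z hz using hz
  have ht : ∀ P : Ideal T, ∃ t : T, P ∈ C → Ideal.Quotient.mk P (u + x * (z P * t)) ∉ B P := by
    intro P
    by_cases hP : P ∈ C
    · have := hC P hP
      by_contra! hcon
      have hinj : Function.Injective (fun t : T ⧸ P => Ideal.Quotient.mk P u +
          Ideal.Quotient.mk P (x * z P) * t) := by
        intro s t hst
        refine mul_left_cancel₀ ?_ (add_left_cancel hst)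
        rw [Ne, Ideal.Quotient.eq_zero_iff_mem]
        exact fun h => (this.mem_or_mem h).elim (hx P hP) (hz P hP).2
      refine (hB P hP).not_ge (mk_le_of_injective (hinj.codRestrict (s := B P) ?_))
      intro t
      obtain ⟨t, rfl⟩ := Ideal.Quotient.mk_surjective t
      convert (hcon t).2 using 1
      simp [mul_assoc]
    · exact ⟨0, fun h => absurd h hP⟩
  choose t ht using ht
  refine ⟨u + x * ∑ P ∈ C, z P * t P, by simp, fun P hP => ?_⟩
  convert ht P hP using 2
  rw [Ideal.Quotient.mk_eq_mk_iff_sub_mem, add_sub_add_left_eq_sub, ← mul_sub,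
    ← Finset.add_sum_erase _ _ hP, add_sub_cancel_left]
  refine P.mul_mem_left _ (Ideal.sum_mem _ fun P' hP' => ?_)
  rw [Finset.mem_erase] at hP'
  exact P.mul_mem_right _ ((hz P' hP'.2).1 P hP hP'.1.symm)

lemma cardinalMk_roots_quotient_le {P : Ideal T} (hP : P.IsPrime) (R : Subring T) :
    #{z : T ⧸ P | ∃ g : Polynomial R, (∃ n, (g.coeff n : T) ∉ P) ∧
      Polynomial.eval₂ ((Ideal.Quotient.mk P).comp R.subtype) z g = 0} ≤ max #R ℵ₀ := by
  let f := (Ideal.Quotient.mk P).comp R.subtype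
  let S : {g : Polynomial R // ∃ n, (g.coeff n : T) ∉ P} → Set (T ⧸ P) :=
    fun g => {z | z ∈ (g.1.map f).roots}
  have hsub : {z : T ⧸ P | ∃ g : Polynomial R, (∃ n, (g.coeff n : T) ∉ P) ∧
      Polynomial.eval₂ ((Ideal.Quotient.mk P).comp R.subtype) z g = 0} ⊆ ⋃ g, S g := by
    rintro z ⟨g, ⟨n, hn⟩, hz⟩
    refine Set.mem_iUnion.2 ⟨⟨g, n, hn⟩, ?_⟩
    refine (Polynomial.mem_roots fun h => hn ?_).2 ?_
    · have := congrArg (Polynomial.coeff · n) h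
      simpa [f, Ideal.Quotient.eq_zero_iff_mem] using this
    · rw [Polynomial.IsRoot.def, Polynomial.eval_map]; exact hz
  refine (mk_le_mk_of_subset hsub).trans ((mk_iUnion_le S).trans ?_)
  have hS : ⨆ g, #(S g) ≤ ℵ₀ := by
    refine ciSup_le' fun g => ?_
    classical
    have : S g = ((g.1.map f).roots.toFinset : Set (T ⧸ P)) := by ext; simp [S]
    rw [this]
    exact (Finset.finite_toSet _).countable.le_aleph0
  have hP : #{g : Polynomial R // ∃ n, (g.coeff n : T) ∉ P} ≤ max #R ℵ₀ :=
    (mk_subtype_le _).trans Polynomial.cardinalMk_le_max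
  refine (mul_le_mul' hP hS).trans ?_
  exact (mul_le_max _ _).trans (by simp)

lemma exists_isGeneric_dvd_sub [IsLocalRing T] [IsNoetherianRing T]
    [IsAdicComplete (IsLocalRing.maximalIdeal T) T] {k : ℕ} {Q : Fin k → Ideal T}
    (hk : 0 < k) (hQ : ∀ i, (Q i).IsPrime) (hQm : ∀ i, Q i ≠ IsLocalRing.maximalIdeal T)
    (hQinc : ∀ i j, Q i ≤ Q j → Q i = Q j) {R : Subring T} (hR : #R < #T)
    (u : T) {x : T} (hx : ∀ i, x ∉ Q i) :
    ∃ y, x ∣ y - u ∧ IsGeneric Q R y := by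
  classical
  obtain ⟨y, hy, hyB⟩ := exists_dvd_sub_of_cardinalMk_lt (C := Finset.univ.image Q)
    (by simpa using hQ) (by simpa using hQinc)
    (fun P => {z : T ⧸ P | ∃ g : Polynomial R, (∃ n, (g.coeff n : T) ∉ P) ∧
      Polynomial.eval₂ ((Ideal.Quotient.mk P).comp R.subtype) z g = 0})
    (by
      simp only [Finset.mem_image, Finset.mem_univ, true_and, forall_exists_index,
        forall_apply_eq_imp_iff]
      intro i
      exact (cardinalMk_roots_quotient_le (hQ i) R).trans_lt
        ((max_lt hR (aleph0_lt_cardinalMk (hQ ⟨0, hk⟩) (hQm _))).trans_le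
          (cardinalMk_le_cardinalMk_quotient (hQ i) (hQm i)))) u
    (x := x) (by simpa using hx)
  refine ⟨y, hy, fun i g hg hgy => hyB (Q i) (by simp) ⟨g, hg, ?_⟩⟩
  rw [← Polynomial.hom_eval₂, Ideal.Quotient.eq_zero_iff_mem]
  exact hgy

end Generic

section TransfiniteChoice

open Cardinal

lemma exists_family_forall_image_Iio {ι T : Type u} [LinearOrder ι] [WellFoundedLT ι]
    (S : Set T → ι → T → Prop) (h : ∀ (s : Set T) (a : ι), #s ≤ #(Set.Iio a) → ∃ y, S s a y) :
    ∃ y : ι → T, ∀ a, S (y '' Set.Iio a) a (y a) := by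
  classical
  let F : ∀ a : ι, (∀ b : ι, b < a → T) → T := fun a rec =>
    Classical.choose (h (Set.range fun b : Set.Iio a => rec b.1 b.2) a mk_range_le)
  refine ⟨WellFoundedLT.fix F, fun a => ?_⟩
  have := Classical.choose_spec
    (h (Set.range fun b : Set.Iio a => WellFoundedLT.fix F b.1) a mk_range_le)
  rw [WellFoundedLT.fix_eq, Set.image_eq_range]
  exact this

lemma exists_factorable_subring {T : Type u} [CommRing T] [IsLocalRing T] [IsNoetherianRing T]
    [IsAdicComplete (IsLocalRing.maximalIdeal T) T] {k : ℕ} {Q : Fin k → Ideal T} {p : T}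
    (hk : 0 < k) (hQ : ∀ i, (Q i).IsPrime) (hQm : ∀ i, Q i ≠ IsLocalRing.maximalIdeal T)
    (hQinc : ∀ i j, Q i ≤ Q j → Q i = Q j)
    (hp : p ∈ nonZeroDivisors T) (hpQ : ∀ i, p ∈ Q i)
    (hreg : ∀ z, (∀ i, z ∉ Q i) → ∀ x, p ∣ z * x → p ∣ x)
    (h0 : IsFactorable Q p (Subring.closure {p})) :
    ∃ R : Subring T, p ∈ R ∧ IsFactorable Q p R ∧
      ∀ u x, (∀ i, x ∉ Q i) → ∃ a ∈ R, x ∣ a - u := by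
  classical
  have hT : ℵ₀ < #T := aleph0_lt_cardinalMk (hQ ⟨0, hk⟩) (hQm _)
  let ι := T × {x : T // ∀ i, x ∉ Q i}
  have hι : #ι ≤ #T := by
    rw [← mul_def]
    exact (mul_le_mul' le_rfl (mk_subtype_le _)).trans_eq (mul_eq_self hT.le)
  obtain ⟨_, _, hord⟩ := exists_ord_eq_type_lt ι
  obtain ⟨y, hy⟩ := exists_family_forall_image_Iio (ι := ι) (T := T)
    (fun s a y => a.2.1 ∣ y - a.1 ∧
      IsGeneric Q (fracClosure (Subring.closure (insert p s))) y) (by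
    intro s a hs
    refine exists_isGeneric_dvd_sub hk hQ hQm hQinc ?_ a.1 a.2.2
    have h1 : #s < #T := (hs.trans_lt (mk_Iio_lt a hord)).trans_le hι
    have h2 : #(insert p s : Set T) < #T := mk_insert_le.trans_lt
      (add_lt_of_lt hT.le h1 (one_lt_aleph0.trans hT))
    have h3 := (Subring.cardinalMk_closure_le_max _).trans_lt (max_lt h2 hT)
    exact (cardinalMk_fracClosure_le _).trans_lt (max_lt h3 hT))
  have hfin : ∀ F : Finset ι, IsFactorable Q p (Subring.closure (insert p (y '' F))) := by
    intro F
    induction F using Finset.induction_on_max with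
    | empty => simpa using h0
    | insert a F hF ih =>
      rw [Finset.coe_insert, Set.image_insert_eq, Set.insert_comm]
      refine ih.closure_insert hk hp hpQ (Set.mem_insert _ _) hreg ((hy a).2.mono ?_)
      exact fracClosure_mono (Subring.closure_mono
        (Set.insert_subset_insert (Set.image_mono fun b hb => hF b hb)))
  have hdir : Directed (· ≤ ·) fun F : Finset ι => Subring.closure (insert p (y '' F)) := by
    refine directed_of_isDirected_le fun F G hFG => Subring.closure_mono ?_
    exact Set.insert_subset_insert (Set.image_mono (by simpa using hFG))
  refine ⟨⨆ F : Finset ι, Subring.closure (insert p (y '' F)), ?_, ?_, ?_⟩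
  · exact (Subring.mem_iSup_of_directed hdir).2
      ⟨∅, Subring.subset_closure (Set.mem_insert _ _)⟩
  · intro r hr
    obtain ⟨F, hF⟩ := (Subring.mem_iSup_of_directed hdir).1 hr
    exact hfin F r hF
  · intro u x hx
    refine ⟨y (u, ⟨x, hx⟩), (Subring.mem_iSup_of_directed hdir).2 ⟨{(u, ⟨x, hx⟩)}, ?_⟩,
      (hy (u, ⟨x, hx⟩)).1⟩
    exact Subring.subset_closure (by simp)

end TransfiniteChoice

section Completion

lemma exists_adicCompletion_equiv {A T : Type*} [CommRing A] [CommRing T] (f : A →+* T)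
    {I : Ideal A} {J : Ideal T} [IsAdicComplete J T] (hIJ : ∀ n, (J ^ n).comap f = I ^ n)
    (hf : ∀ n, Function.Surjective ((Ideal.Quotient.mk (J ^ n)).comp f)) :
    ∃ φ : AdicCompletion I A ≃+* T, ∀ a, φ (algebraMap A (AdicCompletion I A) a) = f a := by
  let q : ∀ n, A ⧸ I ^ n →+* T ⧸ J ^ n := fun n => Ideal.quotientMap _ f (hIJ n).ge
  have hq : ∀ n, Function.Bijective (q n) := fun n =>
    ⟨Ideal.quotientMap_injective' (hIJ n).le, fun t => by
      obtain ⟨a, ha⟩ := hf n t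
      exact ⟨Ideal.Quotient.mk _ a, by simpa [q] using ha⟩⟩
  have hev : ∀ {m n : ℕ} (hle : m ≤ n) (x : AdicCompletion I A),
      Ideal.Quotient.factorPow I hle (AdicCompletion.evalₐ I n x) = AdicCompletion.evalₐ I m x := by
    intro m n hle x
    obtain ⟨a, rfl⟩ := AdicCompletion.mk_surjective I A x
    simp only [AdicCompletion.evalₐ_mk, Ideal.Quotient.factor_mk]
    exact AdicCompletion.Ideal.mk_eq_mk I hle a
  let φ : AdicCompletion I A →+* T := IsAdicComplete.liftRingHom J
    (fun n => (q n).comp (AdicCompletion.evalₐ I n : AdicCompletion I A →+* A ⧸ I ^ n)) (by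
      intro m n hle
      ext x
      obtain ⟨a, ha⟩ := Ideal.Quotient.mk_surjective (AdicCompletion.evalₐ I n x)
      simp only [RingHom.comp_apply, RingHom.coe_coe]
      rw [← hev hle x, ← ha]
      simp [q])
  have hφ : ∀ n x, Ideal.Quotient.mk (J ^ n) (φ x) = q n (AdicCompletion.evalₐ I n x) :=
    fun n x => IsAdicComplete.mk_liftRingHom _ _ _ n x
  have hext : ∀ s t : T, (∀ n, Ideal.Quotient.mk (J ^ n) s = Ideal.Quotient.mk (J ^ n) t) →
      s = t := by
    intro s t h
    rw [IsHausdorff.eq_iff_smodEq (I := J)]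
    intro n
    rw [SModEq.sub_mem, smul_eq_mul, Ideal.mul_top, ← Ideal.Quotient.mk_eq_mk_iff_sub_mem]
    exact h n
  refine ⟨RingEquiv.ofBijective φ ⟨fun x y hxy => ?_, fun t => ?_⟩, fun a => ?_⟩
  · refine AdicCompletion.ext_evalₐ fun n => (hq n).1 ?_
    rw [← hφ, ← hφ, hxy]
  · choose a ha using fun n => hf n (Ideal.Quotient.mk _ t)
    have hcauchy : ∀ m n, m ≤ n → a m ≡ a n [SMOD (I ^ m • ⊤ : Submodule A A)] := by
      intro m n hmn
      rw [SModEq.sub_mem, smul_eq_mul, Ideal.mul_top, ← hIJ, Ideal.mem_comap, map_sub,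
        ← Ideal.Quotient.mk_eq_mk_iff_sub_mem]
      refine (ha m).trans (Eq.symm ?_)
      rw [Ideal.Quotient.mk_eq_mk_iff_sub_mem]
      exact Ideal.pow_le_pow_right hmn
        ((Ideal.Quotient.mk_eq_mk_iff_sub_mem _ _).1 (ha n))
    let b : AdicCompletion.AdicCauchySequence I A := ⟨a, fun {m n} h => hcauchy m n h⟩
    refine ⟨AdicCompletion.mk I A b, hext _ _ fun n => ?_⟩
    rw [hφ, AdicCompletion.evalₐ_mk, ← ha n]
    rfl
  · refine hext _ _ fun n => ?_
    change Ideal.Quotient.mk (J ^ n) (φ _) = _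
    rw [hφ, AlgHom.commutes]
    simp [q]

end Completion

section Construction

open IsLocalRing

variable {T : Type u} [CommRing T] {k : ℕ} {Q : Fin k → Ideal T} {p : T}

lemma dvd_of_dvd_mul_of_associatedPrimes [IsNoetherianRing T]
    (hAss : ∀ P ∈ associatedPrimes T (T ⧸ Ideal.span {p}), ∀ x ∈ P, ∃ i, x ∈ Q i) {z : T}
    (hz : ∀ i, z ∉ Q i) {x : T} (h : p ∣ z * x) : p ∣ x := by
  by_contra hx
  have hx0 : Ideal.Quotient.mk (Ideal.span {p}) x ≠ 0 := by
    rwa [Ne, Ideal.Quotient.eq_zero_iff_mem, Ideal.mem_span_singleton]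
  obtain ⟨P, hP, hle⟩ := exists_le_isAssociatedPrime_of_isNoetherianRing T _ hx0
  obtain ⟨i, hi⟩ := hAss P hP z (hle (by
    rw [Submodule.mem_colon_singleton, Submodule.mem_bot, Algebra.smul_def,
      Ideal.Quotient.algebraMap_eq, ← map_mul, Ideal.Quotient.eq_zero_iff_mem,
      Ideal.mem_span_singleton]
    exact h))
  exact hz i hi

lemma isFactorable_closure_singleton [IsLocalRing T] [IsNoetherianRing T]
    (hpm : p ∈ maximalIdeal T)
    (h : ∀ i : Fin k, ∀ t ∈ CompAvoid (Q i) p ((Subring.closure {p} : Subring T) : Set T),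
      t ∈ Subring.closure ({p} : Set T) → t = 0) :
    IsFactorable Q p (Subring.closure {p}) := by
  intro r hr hr0
  have hfin : FiniteMultiplicity p r := by
    by_contra hinf
    have hmem : r ∈ ⨅ n : ℕ, Ideal.span {p} ^ n := by
      refine Ideal.mem_iInf.2 fun n => ?_
      rw [Ideal.span_singleton_pow, Ideal.mem_span_singleton]
      exact FiniteMultiplicity.not_iff_forall.1 hinf n
    rw [Ideal.iInf_pow_eq_bot_of_isLocalRing _ (Ideal.span_singleton_ne_top hpm),
      Ideal.mem_bot] at hmem
    exact hr0 hmem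
  obtain ⟨t, ht, htp⟩ := hfin.exists_eq_pow_mul_and_not_dvd
  have hpow : p ^ multiplicity p r ∈ Subring.closure ({p} : Set T) :=
    pow_mem (Subring.mem_closure_of_mem (Set.mem_singleton p)) _
  refine ⟨_, t, ht, fun i hi => hr0 (h i r ⟨t, hi, ?_, _, hpow, ht.trans (mul_comm _ _)⟩ hr)⟩
  rwa [Ideal.mem_span_singleton]

lemma comap_map_subtype_eq {A : Subring T} (hA : IsFactorable Q p A)
    (hdiv : ∀ a ∈ A, a ≠ 0 → ∀ s, a * s ∈ A → s ∈ A)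
    (happrox : ∀ u x, (∀ i, x ∉ Q i) → ∃ a ∈ A, x ∣ a - u) (I : Ideal A) :
    (I.map A.subtype).comap A.subtype = I := by
  classical
  refine le_antisymm ?_ Ideal.le_comap_map
  rcases eq_or_ne I ⊥ with rfl | hI
  · rw [Ideal.map_bot]
    intro c hc
    simpa using hc
  have hex : ∃ (e : ℕ) (d : A), d ∈ I ∧ d ≠ 0 ∧ ∃ b, (d : T) = p ^ e * b ∧ ∀ i, b ∉ Q i := by
    obtain ⟨d, hd, hd0⟩ := Submodule.exists_mem_ne_zero_of_ne_bot hI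
    obtain ⟨e, b, hb, hbQ⟩ := hA d d.2 (by simpa using hd0)
    exact ⟨e, d, hd, hd0, b, hb, hbQ⟩
  obtain ⟨d, hd, hd0, b, hb, hbQ⟩ := Nat.find_spec hex
  set e := Nat.find hex
  have hd0' : (d : T) ≠ 0 := by simpa using hd0
  have hdvd : ∀ c ∈ I, p ^ e ∣ (c : T) := by
    intro c hc
    rcases eq_or_ne c 0 with rfl | hc0
    · simp
    obtain ⟨f, t, ht, htQ⟩ := hA c c.2 (by simpa using hc0)
    rw [ht]
    exact (pow_dvd_pow p (Nat.find_min' hex ⟨c, hc, hc0, t, ht, htQ⟩)).mul_right _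
  have key : ∀ c ∈ I.map A.subtype, ∃ c₀ ∈ I, (d : T) ∣ c - c₀ := by
    intro c hc
    induction hc using Submodule.span_induction with
    | mem x hx =>
      obtain ⟨c, hc, rfl⟩ := hx
      exact ⟨c, hc, by simp⟩
    | zero => exact ⟨0, I.zero_mem, by simp⟩
    | add x y _ _ hx hy =>
      obtain ⟨x₀, hx₀, hx⟩ := hx
      obtain ⟨y₀, hy₀, hy⟩ := hy
      refine ⟨x₀ + y₀, I.add_mem hx₀ hy₀, ?_⟩
      convert dvd_add hx hy using 1
      push_cast
      ring
    | smul t x _ hx =>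
      obtain ⟨x₀, hx₀, hx⟩ := hx
      obtain ⟨a, ha, hat⟩ := happrox t b hbQ
      refine ⟨⟨a, ha⟩ * x₀, I.mul_mem_left _ hx₀, ?_⟩
      have h1 : (d : T) ∣ (a - t) * x₀ := by
        rw [hb, mul_comm (p ^ e)]
        exact mul_dvd_mul hat (hdvd x₀ hx₀)
      convert dvd_sub (hx.mul_left t) h1 using 1
      rw [smul_eq_mul, Subring.coe_mul]
      ring
  intro c hc
  obtain ⟨c₀, hc₀, s, hs⟩ := key c hc
  have hsA : s ∈ A := hdiv d d.2 hd0' s (hs ▸ (c - c₀).2)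
  have : c = c₀ + d * ⟨s, hsA⟩ := by
    refine Subtype.ext ?_
    push_cast
    rw [← hs]
    simp
  rw [this]
  exact I.add_mem hc₀ (I.mul_mem_right _ hd)

lemma exists_mem_forall_notMem_of_not_le (hQ : ∀ i, (Q i).IsPrime) {J : Ideal T}
    (hJ : ∀ i, ¬ J ≤ Q i) : ∃ x ∈ J, ∀ i, x ∉ Q i := by
  by_contra! h
  have hsub : (J : Set T) ⊆
      ⋃ i ∈ ((Finset.univ : Finset (Fin k)) : Set (Fin k)), (Q i : Set T) := by
    intro x hx
    obtain ⟨i, hi⟩ := h x hx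
    simpa using ⟨i, hi⟩
  rcases k with _ | k
  · obtain ⟨i, _⟩ := h 0 J.zero_mem
    exact i.elim0
  · obtain ⟨i, _, hi⟩ := (Ideal.subset_union_prime 0 0 fun i _ _ _ => hQ i).1 hsub
    exact hJ i hi

lemma exists_mem_inter_forall_notMem [IsLocalRing T] (hQ : ∀ i, (Q i).IsPrime)
    (hQm : ∀ i, Q i ≠ maximalIdeal T) {A : Subring T}
    (happrox : ∀ u x, (∀ i, x ∉ Q i) → ∃ a ∈ A, x ∣ a - u) {J : Ideal T}
    (hJ : ∀ i, ¬ J ≤ Q i) : ∃ a ∈ A, a ∈ J ∧ ∀ i, a ∉ Q i := by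
  obtain ⟨x, hxJ, hx⟩ := exists_mem_forall_notMem_of_not_le hQ hJ
  obtain ⟨y, hym, hy⟩ := exists_mem_forall_notMem_of_not_le hQ
    (J := maximalIdeal T) fun i h => hQm i (le_antisymm (le_maximalIdeal (hQ i).ne_top) h)
  obtain ⟨a, ha, z, hz⟩ := happrox x (x * y) fun i h => ((hQ i).mem_or_mem h).elim (hx i) (hy i)
  have hax : a = x * (1 + y * z) := by linear_combination hz
  have hu : IsUnit (1 + y * z) := by
    have hyz : y * z ∈ maximalIdeal T := Ideal.mul_mem_right _ _ hym
    by_contra h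
    exact (maximalIdeal.isMaximal T).ne_top ((Ideal.eq_top_iff_one _).2
      ((Ideal.add_mem_iff_left _ hyz).1 ((mem_maximalIdeal _).2 h)))
  refine ⟨a, ha, hax ▸ J.mul_mem_right _ hxJ, fun i hi => ?_⟩
  rw [hax] at hi
  exact ((hQ i).mem_or_mem hi).elim (hx i)
    fun h => (hQ i).ne_top (Ideal.eq_top_of_isUnit_mem _ h hu)

lemma surjective_quotient_comp_subtype (hQ : ∀ i, (Q i).IsPrime) {A : Subring T}
    (happrox : ∀ u x, (∀ i, x ∉ Q i) → ∃ a ∈ A, x ∣ a - u) {J : Ideal T}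
    (hJ : ∀ i, ¬ J ≤ Q i) : Function.Surjective ((Ideal.Quotient.mk J).comp A.subtype) := by
  obtain ⟨x, hxJ, hx⟩ := exists_mem_forall_notMem_of_not_le hQ hJ
  intro u
  obtain ⟨u, rfl⟩ := Ideal.Quotient.mk_surjective u
  obtain ⟨a, ha, hax⟩ := happrox u x hx
  exact ⟨⟨a, ha⟩, (Ideal.Quotient.mk_eq_mk_iff_sub_mem _ _).2 (J.mem_of_dvd hax hxJ)⟩

lemma map_comap_maximalIdeal [IsLocalRing T] [IsNoetherianRing T] {A : Subring T}
    (h : Function.Surjective ((Ideal.Quotient.mk (maximalIdeal T ^ 2)).comp A.subtype)) :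
    ((maximalIdeal T).comap A.subtype).map A.subtype = maximalIdeal T := by
  refine le_antisymm Ideal.map_comap_le ?_
  refine Submodule.le_of_le_smul_of_le_jacobson_bot (I := maximalIdeal T)
    (IsNoetherian.noetherian _) (jacobson_eq_maximalIdeal ⊥ bot_ne_top).ge fun m hm => ?_
  obtain ⟨a, ha⟩ := h (Ideal.Quotient.mk _ m)
  have ham : (a : T) - m ∈ maximalIdeal T ^ 2 := (Ideal.Quotient.mk_eq_mk_iff_sub_mem _ _).1 ha
  have haI : a ∈ (maximalIdeal T).comap A.subtype := by
    rw [Ideal.mem_comap, ← sub_add_cancel (A.subtype a) m]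
    exact Ideal.add_mem _ (Ideal.pow_le_self two_ne_zero ham) hm
  rw [← sub_sub_cancel (a : T) m]
  refine Submodule.sub_mem _ (Submodule.mem_sup_left (Ideal.mem_map_of_mem _ haI))
    (Submodule.mem_sup_right ?_)
  rwa [smul_eq_mul, ← pow_two]

end Construction

/-- **Lemma 10.** Construction of the local domain `A` with `p ∈ A`, `Â = T`, `pA` prime
with semilocal formal fiber having maximal ideals exactly the elements of `C`, and the
surjectivity property for ideals `J ⊄ Qᵢ`. -/
theorem statement7
    {T : Type u} [CommRing T] [IsLocalRing T] [IsNoetherianRing T]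
    [IsAdicComplete (IsLocalRing.maximalIdeal T) T]
    {k : ℕ} (hk : 0 < k) (Q : Fin k → Ideal T)
    (hQprime : ∀ i, (Q i).IsPrime)
    (hQnonmax : ∀ i, Q i ≠ IsLocalRing.maximalIdeal T)
    (hQinc : ∀ i j, Q i ≤ Q j → Q i = Q j)
    (p : T) (hp0 : p ≠ 0) (hpreg : p ∈ nonZeroDivisors T) (hpQ : ∀ i, p ∈ Q i)
    (hdim : 1 ≤ ringKrullDim T)
    (hAss : ∀ P ∈ associatedPrimes T (T ⧸ Ideal.span {p}), ∀ x ∈ P, ∃ i, x ∈ Q i)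
    (hPi1 : ∀ i : Fin k, ∀ t ∈ CompAvoid (Q i) p ((Subring.closure {p} : Subring T) : Set T),
      t ∈ Subring.closure ({p} : Set T) → t = 0)
    (hPi2 : ∀ P ∈ associatedPrimes T T, ∀ x ∈ Subring.closure ({p} : Set T), x ∈ P → x = 0) :
    ∃ A : Subring T, ∃ hpA : p ∈ A,
      IsNoetherianRing ↥A ∧ IsDomain ↥A ∧ QuasilocalWithMaxIdeal A ∧
      (∃ φ : AdicCompletion ((IsLocalRing.maximalIdeal T).comap A.subtype) ↥A ≃+* T,
        ∀ a : ↥A,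
          φ (algebraMap ↥A (AdicCompletion ((IsLocalRing.maximalIdeal T).comap A.subtype) ↥A) a)
            = (a : T)) ∧
      (Ideal.span {(⟨p, hpA⟩ : ↥A)}).IsPrime ∧
      (∀ i, (Q i).comap A.subtype = Ideal.span {(⟨p, hpA⟩ : ↥A)}) ∧
      (∀ Q' : Ideal T, Q'.IsPrime → Q'.comap A.subtype = Ideal.span {(⟨p, hpA⟩ : ↥A)} →
        ∃ i, Q' ≤ Q i) ∧
      (∀ J : Ideal T, (∀ i, ¬ J ≤ Q i) →
        Function.Surjective ((Ideal.Quotient.mk J).comp A.subtype) ∧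
        ∀ i, ¬ ((J : Set T) ∩ (A : Set T) ⊆ (Q i : Set T))) := by
  have hpm : p ∈ IsLocalRing.maximalIdeal T :=
    IsLocalRing.le_maximalIdeal (hQprime ⟨0, hk⟩).ne_top (hpQ _)
  have hreg : ∀ z, (∀ i, z ∉ Q i) → ∀ x, p ∣ z * x → p ∣ x :=
    fun z hz x h => dvd_of_dvd_mul_of_associatedPrimes hAss hz h
  obtain ⟨R, hpR, hR, hRapprox⟩ := exists_factorable_subring hk hQprime hQnonmax hQinc hpreg hpQ
    hreg (isFactorable_closure_singleton hpm hPi1)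
  have hpA : p ∈ fracClosure R := le_fracClosure R hpR
  have hA : IsFactorable Q p (fracClosure R) := hR.fracClosure hk hpreg hpQ hreg
  have hAreg : ∀ a ∈ fracClosure R, a ≠ 0 → a ∈ nonZeroDivisors T :=
    fun a ha ha0 => hA.mem_nonZeroDivisors hpreg hpm hreg ha ha0
  have hdiv : ∀ a ∈ fracClosure R, a ≠ 0 → ∀ s, a * s ∈ fracClosure R → s ∈ fracClosure R :=
    fun a ha ha0 s => mem_fracClosure_of_mul_mem ha (hAreg a ha ha0)
  have happrox : ∀ u x, (∀ i, x ∉ Q i) → ∃ a ∈ fracClosure R, x ∣ a - u := fun u x hx =>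
    (hRapprox u x hx).imp fun a ha => ⟨le_fracClosure R ha.1, ha.2⟩
  have hcomap := comap_map_subtype_eq hA hdiv happrox
  generalize fracClosure R = A at *
  have hsurj : ∀ J : Ideal T, (∀ i, ¬ J ≤ Q i) →
      Function.Surjective ((Ideal.Quotient.mk J).comp A.subtype) :=
    fun J hJ => surjective_quotient_comp_subtype hQprime happrox hJ
  have hpow : ∀ n, Function.Surjective
      ((Ideal.Quotient.mk (IsLocalRing.maximalIdeal T ^ n)).comp A.subtype) :=
    fun n => hsurj _ fun i hi => hQnonmax i (le_antisymm
      (IsLocalRing.le_maximalIdeal (hQprime i).ne_top) ((hQprime i).le_of_pow_le hi))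
  have hQA : ∀ i, (Q i).comap A.subtype = Ideal.span {(⟨p, hpA⟩ : A)} := by
    refine fun i => le_antisymm (fun a ha => ?_) ?_
    · rcases eq_or_ne a 0 with rfl | ha0
      · exact zero_mem _
      obtain ⟨n, t, ht, htQ⟩ := hA a a.2 (by simpa using ha0)
      rcases n with _ | n
      · rw [pow_zero, one_mul] at ht
        exact absurd (ht ▸ ha) (htQ i)
      · rw [pow_succ', mul_assoc] at ht
        exact Ideal.mem_span_singleton.2
          ⟨⟨_, hdiv p hpA hp0 _ (ht ▸ a.2)⟩, Subtype.ext ht⟩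
    · rw [Ideal.span_singleton_le_iff_mem]
      exact hpQ i
  have hinter : ∀ J : Ideal T, (∀ i, ¬ J ≤ Q i) →
      ∀ i, ¬ ((J : Set T) ∩ (A : Set T) ⊆ (Q i : Set T)) := by
    intro J hJ i hi
    obtain ⟨a, haA, haJ, haQ⟩ := exists_mem_inter_forall_notMem hQprime hQnonmax happrox hJ
    exact haQ i (hi ⟨haJ, haA⟩)
  refine ⟨A, hpA, ?_, ?_, ?_, ?_, ?_, hQA, ?_, fun J hJ => ⟨hsurj J hJ, hinter J hJ⟩⟩
  · rw [isNoetherianRing_iff, isNoetherian_iff']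
    exact StrictMono.wellFoundedGT (f := Ideal.map A.subtype)
      ((Ideal.gc_map_comap A.subtype).monotone_l.strictMono_of_injective
        (Function.LeftInverse.injective hcomap))
  · have : NoZeroDivisors A := ⟨fun {a b} hab => by
      by_contra! h
      refine h.2 (Subtype.ext ((mul_left_mem_nonZeroDivisors_eq_zero_iff
        (hAreg a a.2 (by simpa using h.1))).1 (congrArg Subtype.val hab)))⟩
    exact NoZeroDivisors.to_isDomain A
  · intro x hx
    obtain ⟨y, hy⟩ := (isUnit_iff_exists_inv).1 (IsLocalRing.notMem_maximalIdeal.1 hx)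
    have hyA : y ∈ A := hdiv x x.2 (by rintro h; simp [h] at hx) y (hy ▸ one_mem A)
    exact isUnit_iff_exists_inv.2 ⟨⟨y, hyA⟩, Subtype.ext hy⟩
  · refine exists_adicCompletion_equiv A.subtype (J := IsLocalRing.maximalIdeal T)
      (fun n => ?_) hpow
    conv_lhs => rw [← map_comap_maximalIdeal (hpow 2), ← Ideal.map_pow]
    exact hcomap _
  · rw [← hQA ⟨0, hk⟩]
    have := hQprime ⟨0, hk⟩
    exact Ideal.comap_isPrime _ _
  · intro Q' _ hQ'
    by_contra! h
    refine hinter Q' h ⟨0, hk⟩ fun a ha => ?_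
    have : (⟨a, ha.2⟩ : A) ∈ Q'.comap A.subtype := ha.1
    rw [hQ', ← hQA ⟨0, hk⟩] at this
    exact this
end
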